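/- Assume γ ∈ (0,1). Let η ∈ (0,1] and let φ : [0,1] → ℝ be η-Hölder with ∫ φ dν = 0, and set S_n(φ)(x) = Σ_{k=0}^{n−1} φ(T^k(x)). Then there exists a constant C1 > 0 (depending on φ) such that for every x > 0, limsup_{n→∞} n^{−γ} log ν({ S_n(φ) ≥ n x }) ≤ − x^γ / C1. -/

import Mathlib

open MeasureTheory Set Filter

/-- The interval map `T` of the example: `T(x) = x (1 + c / |log x|^β)` on `(0, 1/2]`
with `β = 1/γ - 1`, `c = (log 2)^β`, `T(x) = 2x - 1` on `(1/2, 1]`, and `T(0) = 0`. -/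
noncomputable def Tmap (γ : ℝ) (x : ℝ) : ℝ :=
  if x ≤ 0 then 0
  else if x ≤ 1 / 2 then x * (1 + (Real.log 2) ^ (1 / γ - 1) / |Real.log x| ^ (1 / γ - 1))
  else 2 * x - 1

namespace LD

/-- `v(x) = c / |log x|^β`. -/
noncomputable def vv (β x : ℝ) : ℝ := (Real.log 2) ^ β / |Real.log x| ^ β
/-- Left branch. -/
noncomputable def fL (β x : ℝ) : ℝ := x * (1 + vv β x)
/-- Derivative of the left branch. -/
noncomputable def dL (β x : ℝ) : ℝ := 1 + vv β x + β * vv β x / (-Real.log x)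

lemma log2_pos : 0 < Real.log 2 := Real.log_pos (by norm_num)

lemma neglog_pos {x : ℝ} (h0 : 0 < x) (h1 : x < 1) : 0 < -Real.log x := by
  have := Real.log_neg h0 h1; linarith

lemma neglog_ge {x : ℝ} (h0 : 0 < x) (h1 : x ≤ 1/2) : Real.log 2 ≤ -Real.log x := by
  have := Real.log_le_log h0 h1
  rw [one_div, Real.log_inv] at this; linarith

lemma vv_eq {β x : ℝ} (h0 : 0 < x) (h1 : x < 1) :
    vv β x = (Real.log 2) ^ β * (-Real.log x) ^ (-β) := by
  unfold vv
  rw [abs_of_neg (Real.log_neg h0 h1), Real.rpow_neg (neglog_pos h0 h1).le, div_eq_mul_inv]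

lemma vv_pos {β x : ℝ} (h0 : 0 < x) (h1 : x < 1) : 0 < vv β x := by
  rw [vv_eq h0 h1]
  have := log2_pos
  have := neglog_pos h0 h1
  positivity

lemma vv_half {β : ℝ} : vv β (1/2) = 1 := by
  have := log2_pos
  unfold vv
  rw [one_div, Real.log_inv, abs_neg, abs_of_pos this]
  exact div_self (by positivity)

lemma vv_mono {β : ℝ} (hβ : 0 < β) {x y : ℝ} (h0 : 0 < x) (hxy : x ≤ y) (h1 : y < 1) :
    vv β x ≤ vv β y := by
  have hy := neglog_pos (h0.trans_le hxy) h1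
  have := log2_pos
  rw [vv_eq h0 (by linarith), vv_eq (by linarith) h1]
  have hl := Real.log_le_log h0 hxy
  have : (-Real.log x) ^ (-β) ≤ (-Real.log y) ^ (-β) :=
    Real.rpow_le_rpow_of_nonpos hy (by linarith) (by linarith)
  gcongr

lemma vv_le_one {β : ℝ} (hβ : 0 < β) {x : ℝ} (h0 : 0 < x) (h1 : x ≤ 1/2) : vv β x ≤ 1 := by
  rw [← vv_half (β := β)]; exact vv_mono hβ h0 h1 (by norm_num)

lemma hasDeriv_vv {β x : ℝ} (h0 : 0 < x) (h1 : x < 1) :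
    HasDerivAt (vv β) (β * vv β x / (-Real.log x) / x) x := by
  have hu := neglog_pos h0 h1
  have h : HasDerivAt (fun x => (Real.log 2) ^ β * (-Real.log x) ^ (-β))
      ((Real.log 2) ^ β * (-(x⁻¹) * (-β) * (-Real.log x) ^ (-β - 1))) x :=
    ((((Real.hasDerivAt_log h0.ne').neg).rpow_const (Or.inl hu.ne')).const_mul _)
  have h2 : HasDerivAt (vv β) ((Real.log 2) ^ β * (-(x⁻¹) * (-β) * (-Real.log x) ^ (-β - 1))) x := by
    refine h.congr_of_eventuallyEq ?_
    filter_upwards [Ioo_mem_nhds h0 h1] with y hy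
    exact vv_eq hy.1 hy.2
  convert h2 using 1
  rw [vv_eq h0 h1, Real.rpow_sub hu, Real.rpow_one]
  field_simp

lemma hasDeriv_fL {β x : ℝ} (h0 : 0 < x) (h1 : x < 1) :
    HasDerivAt (fL β) (dL β x) x := by
  have hu := neglog_pos h0 h1
  have h := (hasDerivAt_id x).mul ((hasDeriv_vv (β := β) h0 h1).const_add 1)
  have h2 : HasDerivAt (fL β) (1 * (1 + vv β x) + id x * (β * vv β x / (-Real.log x) / x)) x := h
  convert h2 using 1
  unfold dL
  simp only [id]
  field_simp

lemma dL_ge {β : ℝ} (hβ : 0 < β) {x : ℝ} (h0 : 0 < x) (h1 : x < 1) : 1 + vv β x ≤ dL β x := by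
  have hu := neglog_pos h0 h1
  have := vv_pos (β := β) h0 h1
  have : 0 ≤ β * vv β x / (-Real.log x) := by positivity
  unfold dL; linarith

lemma dL_pos {β : ℝ} (hβ : 0 < β) {x : ℝ} (h0 : 0 < x) (h1 : x < 1) : 0 < dL β x := by
  have := dL_ge hβ h0 h1
  have := vv_pos (β := β) h0 h1
  linarith

lemma dL_mono {β : ℝ} (hβ : 0 < β) {x y : ℝ} (h0 : 0 < x) (hxy : x ≤ y) (h1 : y < 1) :
    dL β x ≤ dL β y := by
  have h := vv_mono hβ h0 hxy h1
  have hy := neglog_pos (h0.trans_le hxy) h1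
  have hl := Real.log_le_log h0 hxy
  have := vv_pos (β := β) h0 (by linarith)
  have : β * vv β x / (-Real.log x) ≤ β * vv β y / (-Real.log y) := by
    gcongr
    · have := vv_pos (β := β) (h0.trans_le hxy) h1
      positivity
  unfold dL; linarith

lemma hasDeriv_dL {β x : ℝ} (h0 : 0 < x) (h1 : x < 1) :
    HasDerivAt (dL β) (β * vv β x / (-Real.log x) / x * (1 + (β + 1) / (-Real.log x))) x := by
  have hu := neglog_pos h0 h1
  have hv := hasDeriv_vv (β := β) h0 h1
  have h := (hv.const_add 1).add ((hv.const_mul β).div ((Real.hasDerivAt_log h0.ne').neg) hu.ne')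
  have h2 : HasDerivAt (dL β) _ x := h
  convert h2 using 1
  simp only [Pi.neg_apply]
  have hl : Real.log x ≠ 0 := (Real.log_neg h0 h1).ne
  field_simp
  ring

/-- the weight exponent -/
noncomputable def aa (β : ℝ) : ℝ := 1 + (β + 1) / Real.log 2

lemma aa_pos {β : ℝ} (hβ : 0 < β) : 0 < aa β := by
  have := log2_pos
  unfold aa; positivity

lemma q_mono {β : ℝ} (hβ : 0 < β) :
    MonotoneOn (fun x => (1 + vv β x) ^ (aa β) / dL β x) (Ioc 0 (1/2)) := by
  have key : MonotoneOn (fun x => aa β * Real.log (1 + vv β x) - Real.log (dL β x)) (Ioc 0 (1/2)) := by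
    have hd : ∀ x ∈ Ioc (0:ℝ) (1/2), HasDerivAt
        (fun x => aa β * Real.log (1 + vv β x) - Real.log (dL β x))
        (aa β * ((β * vv β x / (-Real.log x) / x) / (1 + vv β x)) -
          (β * vv β x / (-Real.log x) / x * (1 + (β + 1) / (-Real.log x))) / dL β x) x := by
      intro x hx
      have h1 : x < 1 := by linarith [hx.2]
      have hp := vv_pos (β := β) hx.1 h1
      exact ((((hasDeriv_vv hx.1 h1).const_add 1).log (by positivity)).const_mul _).sub
        ((hasDeriv_dL hx.1 h1).log (dL_pos hβ hx.1 h1).ne')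
    apply monotoneOn_of_deriv_nonneg (convex_Ioc _ _)
    · exact fun x hx => (hd x hx).continuousAt.continuousWithinAt
    · intro x hx
      rw [interior_Ioc] at hx
      exact (hd x ⟨hx.1, hx.2.le⟩).differentiableAt.differentiableWithinAt
    · intro x hx
      rw [interior_Ioc] at hx
      rw [(hd x ⟨hx.1, hx.2.le⟩).deriv]
      have h1 : x < 1 := by linarith [hx.2]
      have h0 := hx.1
      have hp := vv_pos (β := β) hx.1 h1
      have hu := neglog_pos hx.1 h1
      have hg := neglog_ge hx.1 hx.2.le
      have l2 := log2_pos
      have e1 : (1 + (β + 1) / (-Real.log x)) ≤ aa β := by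
        unfold aa; gcongr
      have e2 := dL_ge hβ hx.1 h1
      rw [sub_nonneg]
      have := aa_pos hβ
      calc _ ≤ (β * vv β x / (-Real.log x) / x * aa β) / (1 + vv β x) := by
            gcongr
        _ = _ := by ring
  intro x hx y hy hxy
  have hx1 : x < 1 := by linarith [hx.2]
  have hy1 : y < 1 := by linarith [hy.2]
  have k := key hx hy hxy
  have p1 := vv_pos (β := β) hx.1 hx1
  have p2 := vv_pos (β := β) hy.1 hy1
  have d1 := dL_pos hβ hx.1 hx1
  have d2 := dL_pos hβ hy.1 hy1
  have := Real.exp_le_exp.2 k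
  simp only [Real.exp_sub, Real.exp_log d1, Real.exp_log d2] at this
  simpa only [Real.rpow_def_of_pos (show 0 < 1 + vv β x by positivity),
    Real.rpow_def_of_pos (show 0 < 1 + vv β y by positivity), mul_comm] using this

lemma fL_half {β : ℝ} : fL β (1/2) = 1 := by unfold fL; rw [vv_half]; norm_num

lemma fL_pos {β x : ℝ} (h0 : 0 < x) (h1 : x < 1) : 0 < fL β x := by
  have := vv_pos (β := β) h0 h1
  unfold fL; positivity

lemma fL_gt {β x : ℝ} (h0 : 0 < x) (h1 : x < 1) : x < fL β x := by
  have := vv_pos (β := β) h0 h1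
  unfold fL; nlinarith

lemma fL_le_two {β : ℝ} (hβ : 0 < β) {x : ℝ} (h0 : 0 < x) (h1 : x ≤ 1/2) : fL β x ≤ 2 * x := by
  have := vv_le_one hβ h0 h1
  unfold fL; nlinarith

lemma fL_strictMono {β : ℝ} (hβ : 0 < β) {x y : ℝ} (h0 : 0 < x) (hxy : x < y) (h1 : y < 1) :
    fL β x < fL β y := by
  have := vv_mono hβ h0 hxy.le h1
  have := vv_pos (β := β) h0 (by linarith)
  unfold fL; nlinarith

lemma fL_mono {β : ℝ} (hβ : 0 < β) {x y : ℝ} (h0 : 0 < x) (hxy : x ≤ y) (h1 : y < 1) :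
    fL β x ≤ fL β y := by
  rcases hxy.eq_or_lt with h | h
  · rw [h]
  · exact (fL_strictMono hβ h0 h h1).le

lemma fL_superadd {β : ℝ} (hβ : 0 < β) {x t : ℝ} (h0 : 0 < x) (ht : 0 < t) (h1 : x + t < 1) :
    fL β x + fL β t ≤ fL β (x + t) := by
  have a1 := vv_mono hβ h0 (show x ≤ x + t by linarith) h1
  have a2 := vv_mono hβ ht (show t ≤ x + t by linarith) h1
  unfold fL; nlinarith

lemma fL_surj {β : ℝ} (hβ : 0 < β) {y : ℝ} (hy : y ∈ Ioc (0:ℝ) 1) :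
    ∃ x ∈ Ioc (0:ℝ) (1/2), fL β x = y := by
  have hc : ContinuousOn (fL β) (Icc (y/2) (1/2)) := fun x hx =>
    (hasDeriv_fL (by linarith [hx.1, hy.1]) (by linarith [hx.2])).continuousAt.continuousWithinAt
  have := intermediate_value_Icc (by linarith [hy.2]) hc
  have hm : y ∈ Icc (fL β (y/2)) (fL β (1/2)) := by
    refine ⟨?_, by rw [fL_half]; exact hy.2⟩
    have := fL_le_two hβ (show 0 < y/2 by linarith [hy.1]) (by linarith [hy.2])
    linarith
  obtain ⟨x, hx, hxy⟩ := this hm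
  exact ⟨x, ⟨by linarith [hx.1, hy.1], hx.2⟩, hxy⟩

/-- Left inverse branch. -/
noncomputable def gL (β y : ℝ) : ℝ := Function.invFunOn (fL β) (Ioc (0:ℝ) (1/2)) y

lemma gL_mem {β : ℝ} (hβ : 0 < β) {y : ℝ} (hy : y ∈ Ioc (0:ℝ) 1) : gL β y ∈ Ioc (0:ℝ) (1/2) :=
  Function.invFunOn_mem (fL_surj hβ hy)

lemma fL_gL {β : ℝ} (hβ : 0 < β) {y : ℝ} (hy : y ∈ Ioc (0:ℝ) 1) : fL β (gL β y) = y :=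
  Function.invFunOn_eq (fL_surj hβ hy)

lemma fL_mem {β : ℝ} (hβ : 0 < β) {x : ℝ} (hx : x ∈ Ioc (0:ℝ) (1/2)) : fL β x ∈ Ioc (0:ℝ) 1 :=
  ⟨fL_pos hx.1 (by linarith [hx.2]), by linarith [fL_le_two hβ hx.1 hx.2, hx.2]⟩

lemma gL_fL {β : ℝ} (hβ : 0 < β) {x : ℝ} (hx : x ∈ Ioc (0:ℝ) (1/2)) : gL β (fL β x) = x := by
  have h1 := gL_mem hβ (fL_mem hβ hx)
  have h2 := fL_gL hβ (fL_mem hβ hx)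
  by_contra hne
  rcases lt_or_gt_of_ne hne with h | h
  · exact absurd h2 (fL_strictMono hβ h1.1 h (by linarith [hx.2])).ne
  · exact absurd h2 (fL_strictMono hβ hx.1 h (by linarith [h1.2])).ne'

lemma gL_mono {β : ℝ} (hβ : 0 < β) : MonotoneOn (gL β) (Ioc 0 1) := by
  intro x hx y hy hxy
  by_contra h
  push Not at h
  have := fL_strictMono hβ (gL_mem hβ hy).1 h (by linarith [(gL_mem hβ hx).2])
  rw [fL_gL hβ hx, fL_gL hβ hy] at this
  linarith

/-- stretched exponential sequence -/
noncomputable def kap (β : ℝ) : ℝ := min 1 ((Real.log 2) ^ β / 2)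
noncomputable def EE (γ : ℝ) (k : ℕ) : ℝ := Real.exp (-(kap (1/γ-1)) * (k:ℝ) ^ γ)

lemma kap_pos {β : ℝ} : 0 < kap β := by
  have := log2_pos
  unfold kap; positivity

lemma EE_pos {γ : ℝ} {k : ℕ} : 0 < EE γ k := Real.exp_pos _

lemma EE_step {γ : ℝ} (hγ : γ ∈ Ioo (0:ℝ) 1) {x : ℝ} (h0 : 0 < x) (h1 : x ≤ 1/2) (k : ℕ)
    (h : fL (1/γ-1) x ≤ EE γ k) : x ≤ EE γ (k+1) := by
  obtain ⟨g0, g1⟩ := hγ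
  have hβ : 0 < 1/γ-1 := by
    have : 1 < 1/γ := by rw [lt_div_iff₀ g0]; linarith
    linarith
  set β := 1/γ-1 with hb
  have hx1 : x < 1 := by linarith
  have hu := neglog_pos h0 hx1
  have hv := vv_pos (β := β) h0 hx1
  have hv1 := vv_le_one hβ h0 h1
  have hkp := kap_pos (β := β)
  set κ := kap β with hk
  have hlog : Real.log x + Real.log (1 + vv β x) ≤ -κ * (k:ℝ)^γ := by
    have := Real.log_le_log (fL_pos h0 hx1) h
    unfold fL EE at this
    rwa [Real.log_exp, Real.log_mul h0.ne' (by positivity)] at this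
  have hl2 : vv β x / 2 ≤ Real.log (1 + vv β x) := by
    have := Real.one_sub_inv_le_log_of_pos (show 0 < 1 + vv β x by positivity)
    have e : 1 - (1 + vv β x)⁻¹ = vv β x / (1 + vv β x) := by field_simp; ring
    rw [e] at this
    refine le_trans ?_ this
    gcongr; linarith
  suffices hh : κ * ((k:ℝ)+1)^γ ≤ -Real.log x by
    unfold EE
    rw [← Real.log_le_iff_le_exp h0]
    push_cast
    linarith
  by_contra hc
  push Not at hc
  have hkk : (0:ℝ) < (k:ℝ)+1 := by positivity
  -- v lower bound
  have h3 : (κ * ((k:ℝ)+1)^γ) ^ (-β) ≤ (-Real.log x)^(-β) :=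
    Real.rpow_le_rpow_of_nonpos hu hc.le (by linarith)
  have h4 : (κ * ((k:ℝ)+1)^γ) ^ (-β) = κ^(-β) * ((k:ℝ)+1)^(γ-1) := by
    rw [Real.mul_rpow hkp.le (by positivity), ← Real.rpow_mul hkk.le]
    congr 2
    rw [hb]; field_simp; ring
  have h5 : κ ≤ (Real.log 2)^β / 2 * κ^(-β) := by
    have k1 : κ ≤ 1 := min_le_left _ _
    have k2 : κ ≤ (Real.log 2)^β/2 := min_le_right _ _
    have k3 : 1 ≤ κ^(-β) := Real.one_le_rpow_of_pos_of_le_one_of_nonpos hkp k1 (by linarith)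
    nlinarith
  have h6 : ((k:ℝ)+1)^γ - (k:ℝ)^γ ≤ ((k:ℝ)+1)^(γ-1) := by
    have hk0 : (0:ℝ) ≤ k := by positivity
    have e : ((k:ℝ)+1)^(γ-1) = ((k:ℝ)+1)^γ / (k+1) := by rw [Real.rpow_sub hkk, Real.rpow_one]
    have : ((k:ℝ)/(k+1)) ≤ ((k:ℝ)/(k+1))^γ := by
      apply Real.self_le_rpow_of_le_one (by positivity) _ g1.le
      rw [div_le_one hkk]; linarith
    rw [Real.div_rpow hk0 hkk.le, div_le_div_iff₀ hkk (by positivity)] at this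
    rw [e, le_div_iff₀ hkk]
    nlinarith
  have h7 : κ * ((k:ℝ)+1)^(γ-1) ≤ vv β x / 2 := by
    rw [vv_eq h0 hx1]
    have hp : 0 < ((k:ℝ)+1)^(γ-1) := by positivity
    have l2 := log2_pos
    have l3 : 0 < (Real.log 2)^β := by positivity
    calc κ * ((k:ℝ)+1)^(γ-1) ≤ ((Real.log 2)^β / 2 * κ^(-β)) * ((k:ℝ)+1)^(γ-1) := by gcongr
      _ = (Real.log 2)^β * (κ^(-β) * ((k:ℝ)+1)^(γ-1)) / 2 := by ring
      _ ≤ _ := by rw [← h4]; gcongr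
  nlinarith

end LD

namespace LD

lemma beta_pos {γ : ℝ} (hγ : γ ∈ Ioo (0:ℝ) 1) : 0 < 1/γ-1 := by
  have : 1 < 1/γ := by rw [lt_div_iff₀ hγ.1]; linarith [hγ.2]
  linarith

lemma T_left {γ x : ℝ} (h0 : 0 < x) (h1 : x ≤ 1/2) : Tmap γ x = fL (1/γ-1) x := by
  unfold Tmap fL vv
  rw [if_neg (by linarith), if_pos h1]

lemma T_right {γ x : ℝ} (h1 : 1/2 < x) : Tmap γ x = 2*x-1 := by
  unfold Tmap
  rw [if_neg (by linarith), if_neg (by linarith)]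

lemma T_meas (γ : ℝ) : Measurable (Tmap γ) := by
  unfold Tmap
  refine Measurable.ite measurableSet_Iic measurable_const (Measurable.ite measurableSet_Iic ?_ ?_)
  · have : Measurable fun x : ℝ => |Real.log x| ^ (1/γ-1) :=
      (continuous_abs.measurable.comp Real.measurable_log).pow_const _
    exact measurable_id.mul (measurable_const.add (measurable_const.div this))
  · fun_prop

lemma T_mem {γ : ℝ} (hγ : γ ∈ Ioo (0:ℝ) 1) {x : ℝ} (hx : x ∈ Ioc (0:ℝ) 1) :
    Tmap γ x ∈ Ioc (0:ℝ) 1 := by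
  by_cases h : x ≤ 1/2
  · rw [T_left hx.1 h]; exact fL_mem (beta_pos hγ) ⟨hx.1, h⟩
  · push Not at h
    rw [T_right h]; constructor <;> linarith [hx.2]

lemma Tn_mem {γ : ℝ} (hγ : γ ∈ Ioo (0:ℝ) 1) (n : ℕ) {x : ℝ} (hx : x ∈ Ioc (0:ℝ) 1) :
    (Tmap γ)^[n] x ∈ Ioc (0:ℝ) 1 := by
  induction n with
  | zero => simpa using hx
  | succ n ih => rw [Function.iterate_succ_apply']; exact T_mem hγ ih

/-- Lebesgue measure on `(0,1]`. -/
noncomputable def leb : Measure ℝ := volume.restrict (Ioc (0:ℝ) 1)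

/-- measures with decreasing density `h` such that `x^a h` is increasing -/
def IsC (γ : ℝ) (μ : Measure ℝ) : Prop :=
  ∃ h : ℝ → ℝ, (∀ x ∈ Ioc (0:ℝ) 1, 0 ≤ h x) ∧ AntitoneOn h (Ioc (0:ℝ) 1) ∧
    MonotoneOn (fun x => x ^ aa (1/γ-1) * h x) (Ioc (0:ℝ) 1) ∧
    μ = leb.withDensity (fun x => ENNReal.ofReal (h x))

def IsD (γ : ℝ) (μ : Measure ℝ) : Prop :=
  ∃ h : ℝ → ℝ, (∀ x ∈ Ioc (0:ℝ) 1, 0 ≤ h x) ∧ AntitoneOn h (Ioc (0:ℝ) 1) ∧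
    MonotoneOn (fun x => x ^ aa (1/γ-1) * h x) (Ioc (0:ℝ) 1) ∧
    (∀ x ∈ Ioc (0:ℝ) 1, h x ≤ 2 ^ aa (1/γ-1) * h 1) ∧
    μ = leb.withDensity (fun x => ENNReal.ofReal (h x))

lemma IsD.isC {γ : ℝ} {μ : Measure ℝ} (h : IsD γ μ) : IsC γ μ := by
  obtain ⟨h, h1, h2, h3, _, h4⟩ := h
  exact ⟨h, h1, h2, h3, h4⟩

lemma wd_apply (h : ℝ → ENNReal) {A : Set ℝ} (hA : MeasurableSet A) :
    (leb.withDensity h) A = ∫⁻ x in A ∩ Ioc 0 1, h x := by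
  rw [withDensity_apply _ hA, leb, Measure.restrict_restrict hA]

lemma push_generic {T f f' g : ℝ → ℝ} {s : Set ℝ} (hT : Measurable T) (hs : MeasurableSet s)
    (hsI : s ⊆ Ioc 0 1) (hTf : ∀ x ∈ s, T x = f x) (hd : ∀ x ∈ s, HasDerivAt f (f' x) x)
    (hpos : ∀ x ∈ s, 0 < f' x) (hg : ∀ x ∈ s, g (f x) = x) (hfs : ∀ x ∈ s, f x ∈ Ioc (0:ℝ) 1)
    (hgs : ∀ y ∈ Ioc (0:ℝ) 1, g y ∈ s ∧ f (g y) = y) (h : ℝ → ℝ) :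
    ((leb.withDensity (fun x => ENNReal.ofReal (h x))).restrict s).map T =
      leb.withDensity (fun y => ENNReal.ofReal (h (g y) / f' (g y))) := by
  ext A hA
  rw [Measure.map_apply hT hA, Measure.restrict_apply (hT hA), wd_apply _ ((hT hA).inter hs),
    wd_apply _ hA]
  have e1 : (T ⁻¹' A ∩ s) ∩ Ioc 0 1 = T ⁻¹' A ∩ s := by
    apply inter_eq_left.2; exact fun x hx => hsI hx.2
  have e2 : A ∩ Ioc 0 1 = f '' (T ⁻¹' A ∩ s) := by
    ext y
    constructor
    · rintro ⟨hy, hyI⟩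
      refine ⟨g y, ⟨?_, (hgs y hyI).1⟩, (hgs y hyI).2⟩
      rw [mem_preimage, hTf _ (hgs y hyI).1, (hgs y hyI).2]; exact hy
    · rintro ⟨x, ⟨hx, hxs⟩, rfl⟩
      rw [mem_preimage, hTf _ hxs] at hx
      exact ⟨hx, hfs x hxs⟩
  rw [e1, e2, lintegral_image_eq_lintegral_abs_deriv_mul ((hT hA).inter hs)
    (fun x hx => (hd x hx.2).hasDerivWithinAt)]
  · refine setLIntegral_congr_fun ((hT hA).inter hs) ?_
    intro x hx
    have hp := hpos x hx.2
    simp only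
    rw [hg x hx.2, ← ENNReal.ofReal_mul (abs_nonneg _), abs_of_pos hp]
    congr 1; field_simp
  · intro x hx y hy hxy
    rw [← hg x hx.2, ← hg y hy.2, hxy]

lemma push_left {γ : ℝ} (hγ : γ ∈ Ioo (0:ℝ) 1) {μ : Measure ℝ} (hμ : IsC γ μ) :
    IsC γ ((μ.restrict (Ioc 0 (1/2))).map (Tmap γ)) := by
  have hβ := beta_pos hγ
  obtain ⟨h, h0, ha, hm, rfl⟩ := hμ
  set β := 1/γ-1 with hb
  have hlt : ∀ x ∈ Ioc (0:ℝ) (1/2), x < 1 := fun x hx => by linarith [hx.2]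
  have hsub : ∀ x ∈ Ioc (0:ℝ) (1/2), x ∈ Ioc (0:ℝ) 1 := fun x hx => ⟨hx.1, by linarith [hx.2]⟩
  refine ⟨fun y => h (gL β y) / dL β (gL β y), ?_, ?_, ?_, ?_⟩
  · intro y hy
    have hg := gL_mem hβ hy
    exact div_nonneg (h0 _ (hsub _ hg)) (dL_pos hβ hg.1 (hlt _ hg)).le
  · intro y hy z hz hyz
    have hgy := gL_mem hβ hy
    have hgz := gL_mem hβ hz
    have hle := gL_mono hβ hy hz hyz
    exact div_le_div₀ (h0 _ (hsub _ hgy)) (ha (hsub _ hgy) (hsub _ hgz) hle)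
      (dL_pos hβ hgy.1 (hlt _ hgy)) (dL_mono hβ hgy.1 hle (hlt _ hgz))
  · have key : ∀ y ∈ Ioc (0:ℝ) 1, y ^ aa β * (h (gL β y) / dL β (gL β y)) =
        ((gL β y) ^ aa β * h (gL β y)) * ((1 + vv β (gL β y)) ^ aa β / dL β (gL β y)) := by
      intro y hy
      have hgy := gL_mem hβ hy
      have hv := vv_pos (β := β) hgy.1 (hlt _ hgy)
      conv_lhs => rw [← fL_gL hβ hy]
      rw [gL_fL hβ hgy]
      unfold fL
      rw [Real.mul_rpow hgy.1.le (by positivity)]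
      ring
    intro y hy z hz hyz
    have hgy := gL_mem hβ hy
    have hgz := gL_mem hβ hz
    have hle := gL_mono hβ hy hz hyz
    have hv := vv_pos (β := β) hgy.1 (hlt _ hgy)
    simp only
    rw [key y hy, key z hz]
    have hdp := dL_pos hβ hgy.1 (hlt _ hgy)
    refine mul_le_mul (hm (hsub _ hgy) (hsub _ hgz) hle) (q_mono hβ hgy hgz hle) (by positivity) ?_
    exact mul_nonneg (Real.rpow_nonneg hgz.1.le _) (h0 _ (hsub _ hgz))
  · exact push_generic (T_meas γ) measurableSet_Ioc hsub (fun x hx => T_left hx.1 hx.2)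
      (fun x hx => hasDeriv_fL hx.1 (hlt _ hx)) (fun x hx => dL_pos hβ hx.1 (hlt _ hx))
      (fun x hx => gL_fL hβ hx) (fun x hx => fL_mem hβ hx)
      (fun y hy => ⟨gL_mem hβ hy, fL_gL hβ hy⟩) h

lemma push_right {γ : ℝ} (hγ : γ ∈ Ioo (0:ℝ) 1) {μ : Measure ℝ} (hμ : IsC γ μ) :
    IsD γ ((μ.restrict (Ioc (1/2) 1)).map (Tmap γ)) := by
  have hβ := beta_pos hγ
  obtain ⟨h, h0, ha, hm, rfl⟩ := hμ
  set β := 1/γ-1 with hb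
  have hap := aa_pos hβ
  have hsub : ∀ x ∈ Ioc (1/2:ℝ) 1, x ∈ Ioc (0:ℝ) 1 := fun x hx => ⟨by linarith [hx.1], hx.2⟩
  have hg : ∀ y ∈ Ioc (0:ℝ) 1, (1+y)/2 ∈ Ioc (1/2:ℝ) 1 := fun y hy =>
    ⟨by linarith [hy.1], by linarith [hy.2]⟩
  refine ⟨fun y => h ((1+y)/2) / 2, ?_, ?_, ?_, ?_, ?_⟩
  · intro y hy
    have := h0 _ (hsub _ (hg y hy))
    positivity
  · intro y hy z hz hyz
    have := ha (hsub _ (hg y hy)) (hsub _ (hg z hz)) (by linarith)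
    simp only; linarith
  · have key : ∀ y ∈ Ioc (0:ℝ) 1, y ^ aa β * (h ((1+y)/2) / 2) =
        (((1+y)/2) ^ aa β * h ((1+y)/2)) * ((2*y/(1+y)) ^ aa β / 2) := by
      intro y hy
      have e : y = ((1+y)/2) * (2*y/(1+y)) := by
        have : 1 + y ≠ 0 := by linarith [hy.1]
        field_simp
      have hy0 := hy.1
      conv_lhs => rw [e, Real.mul_rpow (by positivity) (by positivity), ← e]
      ring
    intro y hy z hz hyz
    have hy0 := hy.1
    have hz0 := hz.1
    simp only
    rw [key y hy, key z hz]
    refine mul_le_mul (hm (hsub _ (hg y hy)) (hsub _ (hg z hz)) (by linarith)) ?_ (by positivity) ?_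
    · have : 2*y/(1+y) ≤ 2*z/(1+z) := by
        rw [div_le_div_iff₀ (by linarith) (by linarith)]; nlinarith
      gcongr
    · exact mul_nonneg (by positivity) (h0 _ (hsub _ (hg z hz)))
  · intro y hy
    have m := hm (hsub _ (hg y hy)) (show (1:ℝ) ∈ Ioc (0:ℝ) 1 by norm_num) (hg y hy).2
    simp only [Real.one_rpow, one_mul] at m
    have hq : (1/2:ℝ) ^ aa β ≤ ((1+y)/2) ^ aa β :=
      Real.rpow_le_rpow (by norm_num) (by linarith [hy.1]) hap.le
    have h00 := h0 _ (hsub _ (hg y hy))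
    have : (1/2:ℝ) ^ aa β * h ((1+y)/2) ≤ h 1 := le_trans (by gcongr) m
    rw [one_div, Real.inv_rpow (by norm_num)] at this
    have hp : (0:ℝ) < 2 ^ aa β := by positivity
    rw [inv_mul_le_iff₀ hp] at this
    change h ((1+y)/2) / 2 ≤ 2 ^ aa β * (h ((1+1)/2) / 2)
    rw [show ((1:ℝ)+1)/2 = 1 by norm_num]
    linarith
  · have := push_generic (T := Tmap γ) (f := fun x => 2*x-1) (f' := fun _ => 2)
      (g := fun y => (1+y)/2) (s := Ioc (1/2) 1) (T_meas γ) measurableSet_Ioc hsub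
      (fun x hx => T_right hx.1)
      (fun x hx => by simpa using ((hasDerivAt_id x).const_mul (2:ℝ)).sub_const 1)
      (fun x hx => by norm_num)
      (fun x hx => by ring) (fun x hx => ⟨by linarith [hx.1], by linarith [hx.2]⟩)
      (fun y hy => ⟨hg y hy, by ring⟩) h
    exact this

lemma isD_leb {γ : ℝ} (hγ : γ ∈ Ioo (0:ℝ) 1) : IsD γ leb := by
  have hap := aa_pos (beta_pos hγ)
  refine ⟨fun _ => 1, fun _ _ => zero_le_one, fun _ _ _ _ _ => le_rfl, ?_, ?_, ?_⟩
  · intro x hx y hy hxy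
    have := hx.1
    simp only [mul_one]
    gcongr
  · intro x hx
    rw [mul_one]
    exact Real.one_le_rpow (by norm_num) hap.le
  · simp

lemma isC_zero {γ : ℝ} : IsC γ 0 := by
  refine ⟨fun _ => 0, fun _ _ => le_rfl, fun _ _ _ _ _ => le_rfl, ?_, ?_⟩
  · intro x hx y hy hxy; simp
  · simp

lemma IsC.ac {γ : ℝ} {μ : Measure ℝ} (hμ : IsC γ μ) : μ (Ioc 0 1)ᶜ = 0 := by
  obtain ⟨h, h0, ha, hm, rfl⟩ := hμ
  rw [wd_apply _ measurableSet_Ioc.compl]; simp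

lemma IsC.upper {γ : ℝ} {μ : Measure ℝ} (hμ : IsC γ μ) {A : Set ℝ}
    (hA : MeasurableSet A) (hAY : A ⊆ Ioc (1/2) 1) : μ A ≤ 2 * μ univ * volume A := by
  obtain ⟨h, h0, ha, hm, rfl⟩ := hμ
  rw [wd_apply _ hA, wd_apply _ MeasurableSet.univ, univ_inter]
  have hh : (1/2:ℝ) ∈ Ioc (0:ℝ) 1 := by norm_num
  have e : A ∩ Ioc 0 1 = A := inter_eq_left.2 fun x hx => ⟨by linarith [(hAY hx).1], (hAY hx).2⟩
  rw [e]
  have u1 : ∫⁻ x in A, ENNReal.ofReal (h x) ≤ ENNReal.ofReal (h (1/2)) * volume A := by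
    rw [← setLIntegral_const]
    refine setLIntegral_mono' hA fun x hx => ENNReal.ofReal_le_ofReal ?_
    exact ha hh ⟨by linarith [(hAY hx).1], (hAY hx).2⟩ (hAY hx).1.le
  have u2 : ENNReal.ofReal (h (1/2)) * volume (Ioc (0:ℝ) (1/2)) ≤
      ∫⁻ x in Ioc 0 1, ENNReal.ofReal (h x) := by
    rw [← setLIntegral_const]
    refine le_trans (setLIntegral_mono' measurableSet_Ioc fun x hx => ENNReal.ofReal_le_ofReal ?_)
      (lintegral_mono_set (Ioc_subset_Ioc le_rfl (by norm_num : (1/2:ℝ) ≤ 1)))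
    exact ha ⟨hx.1, by linarith [hx.2]⟩ hh hx.2
  refine u1.trans ?_
  gcongr
  have h2 : (2:ENNReal) * volume (Ioc (0:ℝ) (1/2)) = 1 := by
    rw [Real.volume_Ioc, ← ENNReal.ofReal_ofNat, ← ENNReal.ofReal_mul (by norm_num)]
    norm_num
  calc ENNReal.ofReal (h (1/2)) = 2 * (ENNReal.ofReal (h (1/2)) * volume (Ioc (0:ℝ) (1/2))) := by
        rw [mul_left_comm, h2, mul_one]
    _ ≤ _ := by gcongr

lemma IsC.lower {γ : ℝ} (hγ : γ ∈ Ioo (0:ℝ) 1) {μ : Measure ℝ} (hμ : IsC γ μ) {A : Set ℝ}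
    (hA : MeasurableSet A) {δ : ℝ} (hδ : 0 < δ) :
    ENNReal.ofReal (δ ^ aa (1/γ-1)) * μ (Icc δ 1) * leb A ≤ μ A := by
  have hap := aa_pos (beta_pos hγ)
  obtain ⟨h, h0, ha, hm, rfl⟩ := hμ
  rw [wd_apply _ hA, wd_apply _ measurableSet_Icc]
  have h11 : (1:ℝ) ∈ Ioc (0:ℝ) 1 := by norm_num
  have l1 : ENNReal.ofReal (h 1) * leb A ≤ ∫⁻ x in A ∩ Ioc 0 1, ENNReal.ofReal (h x) := by
    rw [leb, Measure.restrict_apply hA, ← setLIntegral_const]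
    refine setLIntegral_mono' (hA.inter measurableSet_Ioc) fun x hx => ENNReal.ofReal_le_ofReal ?_
    exact ha hx.2 h11 hx.2.2
  refine le_trans ?_ l1
  gcongr
  rw [← lintegral_const_mul' _ _ ENNReal.ofReal_ne_top]
  calc ∫⁻ x in Icc δ 1 ∩ Ioc 0 1, ENNReal.ofReal (δ ^ aa (1/γ-1)) * ENNReal.ofReal (h x)
      ≤ ∫⁻ x in Icc δ 1 ∩ Ioc 0 1, ENNReal.ofReal (h 1) := by
        refine setLIntegral_mono' (measurableSet_Icc.inter measurableSet_Ioc) fun x hx => ?_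
        rw [← ENNReal.ofReal_mul (by positivity)]
        apply ENNReal.ofReal_le_ofReal
        have m := hm hx.2 h11 hx.2.2
        simp only [Real.one_rpow, one_mul] at m
        refine le_trans ?_ m
        have := h0 x hx.2
        gcongr
        exact hx.1.1
    _ ≤ ENNReal.ofReal (h 1) * volume (Ioc (0:ℝ) 1) := by
        rw [setLIntegral_const]
        gcongr
        exact inter_subset_right
    _ = _ := by simp

lemma IsD.le {γ : ℝ} {μ : Measure ℝ} (hμ : IsD γ μ) {A : Set ℝ}
    (hA : MeasurableSet A) : μ A ≤ ENNReal.ofReal (2 ^ aa (1/γ-1)) * μ univ * leb A := by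
  obtain ⟨h, h0, ha, hm, hD, rfl⟩ := hμ
  have h11 : (1:ℝ) ∈ Ioc (0:ℝ) 1 := by norm_num
  rw [wd_apply _ hA, wd_apply _ MeasurableSet.univ, univ_inter]
  have l1 : ENNReal.ofReal (h 1) ≤ ∫⁻ x in Ioc 0 1, ENNReal.ofReal (h x) := by
    calc ENNReal.ofReal (h 1) = ∫⁻ x in Ioc (0:ℝ) 1, ENNReal.ofReal (h 1) := by simp
      _ ≤ _ := by
        refine setLIntegral_mono' measurableSet_Ioc fun x hx => ENNReal.ofReal_le_ofReal ?_
        exact ha hx h11 hx.2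
  calc ∫⁻ x in A ∩ Ioc 0 1, ENNReal.ofReal (h x)
      ≤ ∫⁻ x in A ∩ Ioc 0 1, ENNReal.ofReal (2 ^ aa (1/γ-1)) * ENNReal.ofReal (h 1) := by
        refine setLIntegral_mono' (hA.inter measurableSet_Ioc) fun x hx => ?_
        rw [← ENNReal.ofReal_mul (by positivity)]
        exact ENNReal.ofReal_le_ofReal (hD x hx.2)
    _ = ENNReal.ofReal (2 ^ aa (1/γ-1)) * ENNReal.ofReal (h 1) * leb A := by
        rw [setLIntegral_const, leb, Measure.restrict_apply hA]
    _ ≤ _ := by gcongr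

end LD

namespace LD

/-- itinerary of length `n` -/
noncomputable def code (γ : ℝ) : ℕ → ℝ → List Bool
  | 0, _ => []
  | n+1, y => decide (1/2 < y) :: code γ n (Tmap γ y)

lemma code_meas (γ : ℝ) (n : ℕ) (w : List Bool) : MeasurableSet {y | code γ n y = w} := by
  induction n generalizing w with
  | zero => simp only [code]; exact MeasurableSet.const _
  | succ n ih =>
    cases w with
    | nil => simp [code]
    | cons c w =>
      have : {y | code γ (n+1) y = c :: w} =
          {y | decide (1/2 < y) = c} ∩ (Tmap γ) ⁻¹' {y | code γ n y = w} := by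
        ext y; simp [code]
      rw [this]
      refine MeasurableSet.inter ?_ (T_meas γ (ih w))
      cases c
      · have : {y : ℝ | decide (1/2 < y) = false} = Iic (1/2) := by ext y; simp
        rw [this]; exact measurableSet_Iic
      · have : {y : ℝ | decide (1/2 < y) = true} = Ioi (1/2) := by ext y; simp
        rw [this]; exact measurableSet_Ioi

lemma Tn_meas (γ : ℝ) (n : ℕ) : Measurable ((Tmap γ)^[n]) := (T_meas γ).iterate n

lemma restrict_congr_I {γ : ℝ} {μ : Measure ℝ} (hμ : IsC γ μ) {A B : Set ℝ}
    (h : ∀ x ∈ Ioc (0:ℝ) 1, x ∈ A ↔ x ∈ B) : μ.restrict A = μ.restrict B := by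
  apply Measure.restrict_congr_set
  have : ∀ᵐ x ∂μ, x ∈ Ioc (0:ℝ) 1 := by
    rw [ae_iff]; exact hμ.ac
  filter_upwards [this] with x hx
  exact propext (h x hx)

lemma cyl_push {γ : ℝ} (hγ : γ ∈ Ioo (0:ℝ) 1) (n : ℕ) : ∀ (w : List Bool) {μ : Measure ℝ},
    IsC γ μ → IsC γ ((μ.restrict {y | code γ n y = w}).map ((Tmap γ)^[n])) := by
  induction n with
  | zero =>
    intro w μ hμ
    cases w with
    | nil => simpa [code] using hμ
    | cons c w => simpa [code] using isC_zero
  | succ n ih =>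
    intro w μ hμ
    cases w with
    | nil => simpa [code] using isC_zero
    | cons c w =>
      have hS : {y | code γ (n+1) y = c :: w} =
          (Tmap γ) ⁻¹' {y | code γ n y = w} ∩ {y | decide (1/2 < y) = c} := by
        ext y; simp [code, and_comm]
      rw [Function.iterate_succ, ← Measure.map_map (Tn_meas γ n) (T_meas γ), hS,
        ← Measure.restrict_restrict (T_meas γ (code_meas γ n w)),
        ← Measure.restrict_map (T_meas γ) (code_meas γ n w)]
      apply ih
      cases c
      · rw [restrict_congr_I hμ (B := Ioc 0 (1/2))]
        · exact push_left hγ hμ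
        · intro x hx; simp only [mem_ofPred_eq, decide_eq_false_iff_not, not_lt, mem_Ioc]
          exact ⟨fun h => ⟨hx.1, h⟩, fun h => h.2⟩
      · rw [restrict_congr_I hμ (B := Ioc (1/2) 1)]
        · exact (push_right hγ hμ).isC
        · intro x hx; simp only [mem_ofPred_eq, decide_eq_true_eq, mem_Ioc]
          exact ⟨fun h => ⟨h, hx.2⟩, fun h => h.1⟩

lemma cyl_push_D {γ : ℝ} (hγ : γ ∈ Ioo (0:ℝ) 1) (n : ℕ) (w : List Bool) {μ : Measure ℝ}
    (hμ : IsC γ μ) : IsD γ ((μ.restrict ({y | code γ n y = w} ∩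
      ((Tmap γ)^[n]) ⁻¹' (Ioi (1/2)))).map ((Tmap γ)^[n+1])) := by
  rw [Function.iterate_succ', ← Measure.map_map (T_meas γ) (Tn_meas γ n), inter_comm,
    ← Measure.restrict_restrict (Tn_meas γ n measurableSet_Ioi),
    ← Measure.restrict_map (Tn_meas γ n) measurableSet_Ioi]
  have h1 := cyl_push hγ n w hμ
  rw [restrict_congr_I h1 (B := Ioc (1/2) 1)]
  · exact push_right hγ h1
  · intro x hx
    exact ⟨fun h => ⟨h, hx.2⟩, fun h => h.1⟩

lemma EE_zero {γ : ℝ} (hγ : γ ∈ Ioo (0:ℝ) 1) : EE γ 0 = 1 := by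
  unfold EE; rw [Nat.cast_zero, Real.zero_rpow hγ.1.ne']; simp

lemma code_diam {γ : ℝ} (hγ : γ ∈ Ioo (0:ℝ) 1) (n : ℕ) : ∀ {y z : ℝ}, y ∈ Ioc (0:ℝ) 1 →
    z ∈ Ioc (0:ℝ) 1 → code γ n y = code γ n z → |y - z| ≤ EE γ n := by
  have hβ := beta_pos hγ
  induction n with
  | zero =>
    intro y z hy hz _
    rw [EE_zero hγ, abs_le]; constructor <;> linarith [hy.1, hy.2, hz.1, hz.2]
  | succ n ih =>
    intro y z hy hz h
    wlog hyz : y < z generalizing y z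
    · rcases (not_lt.1 hyz).eq_or_lt with e | e
      · rw [e, sub_self, abs_zero]; exact EE_pos.le
      · rw [abs_sub_comm]; exact this hz hy h.symm e
    simp only [code, List.cons.injEq] at h
    have hi := ih (T_mem hγ hy) (T_mem hγ hz) h.2
    rw [abs_sub_comm] at hi
    rw [abs_sub_comm, abs_of_pos (by linarith)]
    by_cases hc : z ≤ 1/2
    · have hy2 : y ≤ 1/2 := by linarith
      rw [T_left hy.1 hy2, T_left hz.1 hc] at hi
      have hs := fL_superadd hβ hy.1 (show 0 < z - y by linarith) (by linarith)
      rw [show y + (z - y) = z by ring] at hs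
      refine EE_step hγ (by linarith) (by linarith [hy.1]) n ?_
      linarith [le_abs_self (fL (1/γ-1) z - fL (1/γ-1) y)]
    · have hyr : 1/2 < y := by
        have h1 := h.1
        rw [decide_eq_decide] at h1
        exact h1.2 (not_le.1 hc)
      rw [T_right hyr, T_right (not_le.1 hc)] at hi
      refine EE_step hγ (by linarith) (by linarith [hz.2]) n ?_
      have := fL_le_two hβ (show 0 < z - y by linarith) (by linarith [hz.2])
      linarith [le_abs_self (2*z-1-(2*y-1))]

lemma code_iter {γ : ℝ} {n : ℕ} (i : ℕ) (hi : i ≤ n) : ∀ {y z : ℝ}, code γ n y = code γ n z →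
    code γ (n-i) ((Tmap γ)^[i] y) = code γ (n-i) ((Tmap γ)^[i] z) := by
  induction i generalizing n with
  | zero => intro y z h; simpa using h
  | succ i ih =>
    intro y z h
    obtain ⟨m, rfl⟩ : ∃ m, n = m+1 := ⟨n-1, by omega⟩
    simp only [code, List.cons.injEq] at h
    have := ih (n := m) (by omega) h.2
    rw [Nat.add_sub_add_right]
    simpa only [Function.iterate_succ_apply] using this

lemma code_iff {γ : ℝ} {n : ℕ} {y z : ℝ} (h : code γ n y = code γ n z) {i : ℕ} (hi : i < n) :
    1/2 < (Tmap γ)^[i] y ↔ 1/2 < (Tmap γ)^[i] z := by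
  have := code_iter i hi.le h
  obtain ⟨m, hm⟩ : ∃ m, n-i = m+1 := ⟨n-i-1, by omega⟩
  rw [hm] at this
  simp only [code, List.cons.injEq, decide_eq_decide] at this
  exact this.1

/-- Birkhoff sums -/
noncomputable def SS (γ : ℝ) (φ : ℝ → ℝ) (n : ℕ) (y : ℝ) : ℝ :=
  ∑ k ∈ Finset.range n, φ ((Tmap γ)^[k] y)

lemma SS_add {γ : ℝ} {φ : ℝ → ℝ} (m n : ℕ) (y : ℝ) :
    SS γ φ (m+n) y = SS γ φ m y + SS γ φ n ((Tmap γ)^[m] y) := by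
  unfold SS
  rw [Finset.sum_range_add]
  congr 1
  refine Finset.sum_congr rfl fun k _ => ?_
  rw [add_comm, Function.iterate_add_apply]

lemma SS_meas {γ : ℝ} {φ : ℝ → ℝ} (hφ : Measurable φ) (n : ℕ) : Measurable (SS γ φ n) := by
  unfold SS
  exact Finset.measurable_sum _ fun k _ => hφ.comp (Tn_meas γ k)

lemma SS_bound {γ : ℝ} {φ : ℝ → ℝ} {M : ℝ} (hM : ∀ x, |φ x| ≤ M) (n : ℕ) (y : ℝ) :
    |SS γ φ n y| ≤ M * n := by
  unfold SS
  refine (Finset.abs_sum_le_sum_abs _ _).trans ?_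
  refine (Finset.sum_le_sum fun k _ => hM _).trans ?_
  simp [mul_comm]

lemma SS_osc {γ : ℝ} (hγ : γ ∈ Ioo (0:ℝ) 1) {η : ℝ} (hη : 0 < η) {φ : ℝ → ℝ} {C : ℝ} (hC : 0 ≤ C)
    (hφ : ∀ x ∈ Ioc (0:ℝ) 1, ∀ y ∈ Ioc (0:ℝ) 1, |φ x - φ y| ≤ C * |x-y| ^ η)
    (hsum : Summable fun k => EE γ k ^ η) (n : ℕ) {y z : ℝ}
    (hy : y ∈ Ioc (0:ℝ) 1) (hz : z ∈ Ioc (0:ℝ) 1) (h : code γ n y = code γ n z) :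
    |SS γ φ (n+1) y - SS γ φ (n+1) z| ≤ C * ∑' k, EE γ k ^ η := by
  unfold SS
  rw [← Finset.sum_sub_distrib]
  refine (Finset.abs_sum_le_sum_abs _ _).trans ?_
  calc ∑ k ∈ Finset.range (n+1), |φ ((Tmap γ)^[k] y) - φ ((Tmap γ)^[k] z)|
      ≤ ∑ k ∈ Finset.range (n+1), C * EE γ (n+1-1-k) ^ η := by
        refine Finset.sum_le_sum fun k hk => ?_
        rw [Finset.mem_range] at hk
        refine (hφ _ (Tn_mem hγ k hy) _ (Tn_mem hγ k hz)).trans ?_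
        have := code_diam hγ (n-k) (Tn_mem hγ k hy) (Tn_mem hγ k hz) (code_iter k (by omega) h)
        rw [Nat.add_sub_cancel]
        gcongr
    _ = ∑ k ∈ Finset.range (n+1), C * EE γ k ^ η :=
        Finset.sum_range_reflect (fun k => C * EE γ k ^ η) (n+1)
    _ = C * ∑ k ∈ Finset.range (n+1), EE γ k ^ η := by rw [Finset.mul_sum]
    _ ≤ _ := by
        gcongr
        exact hsum.sum_le_tsum _ fun k _ => Real.rpow_nonneg EE_pos.le _

lemma IsD.finite {γ : ℝ} {μ : Measure ℝ} (hμ : IsD γ μ) : IsFiniteMeasure μ := by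
  obtain ⟨h, h0, ha, hm, hD, rfl⟩ := hμ
  constructor
  rw [wd_apply _ MeasurableSet.univ, univ_inter]
  refine lt_of_le_of_lt (setLIntegral_mono' measurableSet_Ioc
    (g := fun _ => ENNReal.ofReal (2 ^ aa (1/γ-1) * h 1))
    fun x hx => ENNReal.ofReal_le_ofReal (hD x hx)) ?_
  simp

lemma block {γ : ℝ} (hγ : γ ∈ Ioo (0:ℝ) 1) {μ : Measure ℝ} (hμ : IsD γ μ) (n : ℕ)
    {W H : ℝ → ENNReal} (hWm : Measurable W) (hH : Measurable H) {κ A : ENNReal}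
    (hsupp : ∀ y ∈ Ioc (0:ℝ) 1, W y ≠ 0 → 1/2 < (Tmap γ)^[n] y)
    (hosc : ∀ y ∈ Ioc (0:ℝ) 1, ∀ z ∈ Ioc (0:ℝ) 1, code γ n y = code γ n z →
      1/2 < (Tmap γ)^[n] y → 1/2 < (Tmap γ)^[n] z → W y ≤ κ * W z)
    (hA : ∀ μ', IsD γ μ' → ∫⁻ y, H y ∂μ' ≤ A * μ' univ) :
    ∫⁻ y, W y * H ((Tmap γ)^[n+1] y) ∂μ ≤ A * κ * ∫⁻ y, W y ∂μ := by
  have hfin := hμ.finite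
  set U : List Bool → Set ℝ := fun w => {y | code γ n y = w} ∩ ((Tmap γ)^[n]) ⁻¹' (Ioi (1/2)) with hU
  have hUm : ∀ w, MeasurableSet (U w) := fun w =>
    (code_meas γ n w).inter (Tn_meas γ n measurableSet_Ioi)
  have hdisj : Pairwise (Function.onFun Disjoint U) := by
    intro w w' hne
    rw [Function.onFun, Set.disjoint_left]
    rintro y ⟨h1, _⟩ ⟨h2, _⟩
    exact hne (h1.symm.trans h2)
  have hae : ∀ᵐ x ∂μ, x ∈ Ioc (0:ℝ) 1 := by rw [ae_iff]; exact hμ.isC.ac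
  have hV : MeasurableSet (⋃ w, U w) := MeasurableSet.iUnion hUm
  have hin : ∀ y ∈ Ioc (0:ℝ) 1, y ∉ (⋃ w, U w) → W y = 0 := by
    intro y hy hn
    by_contra h
    exact hn (mem_iUnion.2 ⟨code γ n y, rfl, hsupp y hy h⟩)
  have e1 : ∫⁻ y, W y * H ((Tmap γ)^[n+1] y) ∂μ =
      ∑' w, ∫⁻ y in U w, W y * H ((Tmap γ)^[n+1] y) ∂μ := by
    rw [← lintegral_iUnion hUm hdisj, ← lintegral_add_compl _ hV]
    have z : ∫⁻ y in (⋃ w, U w)ᶜ, W y * H ((Tmap γ)^[n+1] y) ∂μ = 0 := by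
      rw [← lintegral_zero (μ := μ.restrict (⋃ w, U w)ᶜ)]
      apply lintegral_congr_ae
      filter_upwards [ae_restrict_of_ae hae, ae_restrict_mem hV.compl] with y h1 h2
      rw [hin y h1 h2, zero_mul]
    rw [z, add_zero]
  have e2 : ∑' w, ∫⁻ y in U w, W y ∂μ ≤ ∫⁻ y, W y ∂μ := by
    rw [← lintegral_iUnion hUm hdisj]; exact setLIntegral_le_lintegral _ _
  rw [e1]
  refine le_trans ?_ (mul_le_mul_right e2 _)
  rw [← ENNReal.tsum_mul_left]
  refine ENNReal.tsum_le_tsum fun w => ?_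
  set Q := ∫⁻ y in U w, W y * H ((Tmap γ)^[n+1] y) ∂μ with hQ
  have haeU : ∀ᵐ x ∂(μ.restrict (U w)), x ∈ Ioc (0:ℝ) 1 ∧ x ∈ U w :=
    (ae_restrict_of_ae hae).and (ae_restrict_mem (hUm w))
  have hz : ∀ z ∈ Ioc (0:ℝ) 1, z ∈ U w → Q ≤ κ * W z * (A * μ (U w)) := by
    intro z hz hzU
    calc Q ≤ ∫⁻ y in U w, (κ * W z) * H ((Tmap γ)^[n+1] y) ∂μ := by
          apply lintegral_mono_ae
          filter_upwards [haeU] with y hy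
          gcongr
          exact hosc y hy.1 z hz (hy.2.1.trans hzU.1.symm) hy.2.2 hzU.2
      _ = (κ * W z) * ∫⁻ y in U w, H ((Tmap γ)^[n+1] y) ∂μ :=
          lintegral_const_mul _ (hH.comp (Tn_meas γ _))
      _ = (κ * W z) * ∫⁻ y, H y ∂((μ.restrict (U w)).map ((Tmap γ)^[n+1])) := by
          rw [lintegral_map hH (Tn_meas γ _)]
      _ ≤ (κ * W z) * (A * μ (U w)) := by
          gcongr
          refine (hA _ (cyl_push_D hγ n w hμ.isC)).trans ?_
          rw [Measure.map_apply (Tn_meas γ _) MeasurableSet.univ, preimage_univ,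
            Measure.restrict_apply_univ]
  by_cases h0 : μ (U w) = 0
  · have : Q = 0 := by
      rw [hQ, Measure.restrict_eq_zero.2 h0, lintegral_zero_measure]
    rw [this]; exact zero_le
  have hft : μ (U w) ≠ ⊤ := measure_ne_top _ _
  have h3 : Q * μ (U w) ≤ (A * κ * ∫⁻ y in U w, W y ∂μ) * μ (U w) := by
    calc Q * μ (U w) = ∫⁻ z in U w, Q ∂μ := by rw [setLIntegral_const]
      _ ≤ ∫⁻ z in U w, κ * W z * (A * μ (U w)) ∂μ := by
          apply lintegral_mono_ae
          filter_upwards [haeU] with y hy using hz y hy.1 hy.2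
      _ = (A * κ * ∫⁻ y in U w, W y ∂μ) * μ (U w) := by
          rw [lintegral_mul_const _ (hWm.const_mul _), lintegral_const_mul _ hWm]; ring
  exact (ENNReal.mul_le_mul_iff_left h0 hft).1 h3

/-- no visit to `(1/2,1]` in the first `k` steps -/
def NN (γ : ℝ) (k : ℕ) : Set ℝ := {y | y ∈ Ioc (0:ℝ) 1 ∧ ∀ i < k, (Tmap γ)^[i] y ≤ 1/2}

lemma NN_meas (γ : ℝ) (k : ℕ) : MeasurableSet (NN γ k) := by
  have : NN γ k = Ioc 0 1 ∩ ⋂ i, ⋂ (_ : i < k), ((Tmap γ)^[i]) ⁻¹' (Iic (1/2)) := by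
    ext y; simp [NN]
  rw [this]
  exact measurableSet_Ioc.inter (MeasurableSet.iInter fun i => MeasurableSet.iInter fun _ =>
    Tn_meas γ i measurableSet_Iic)

lemma NN_anti (γ : ℝ) : Antitone (NN γ) := fun _ _ h _ hy => ⟨hy.1, fun i hi => hy.2 i (by omega)⟩

lemma NN_le {γ : ℝ} (hγ : γ ∈ Ioo (0:ℝ) 1) (k : ℕ) : ∀ {y}, y ∈ NN γ k → y ≤ EE γ k := by
  induction k with
  | zero => intro y hy; rw [EE_zero hγ]; exact hy.1.2
  | succ k ih =>
    intro y hy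
    have h0 := hy.2 0 (by omega)
    simp only [Function.iterate_zero, id] at h0
    refine EE_step hγ hy.1.1 h0 k ?_
    rw [← T_left hy.1.1 h0]
    refine ih ⟨T_mem hγ hy.1, fun i hi => ?_⟩
    have := hy.2 (i+1) (by omega)
    rwa [Function.iterate_succ_apply] at this

lemma NN_succ {γ : ℝ} (hγ : γ ∈ Ioo (0:ℝ) 1) (k : ℕ) (y : ℝ) (hy : y ∈ Ioc (0:ℝ) 1) :
    y ∈ NN γ (k+1) ↔ y ≤ 1/2 ∧ Tmap γ y ∈ NN γ k := by
  constructor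
  · intro h
    refine ⟨by simpa using h.2 0 (by omega), T_mem hγ hy, fun i hi => ?_⟩
    have := h.2 (i+1) (by omega)
    rwa [Function.iterate_succ_apply] at this
  · rintro ⟨h1, h2⟩
    refine ⟨hy, fun i hi => ?_⟩
    cases i with
    | zero => simpa using h1
    | succ i => rw [Function.iterate_succ_apply]; exact h2.2 i (by omega)

end LD

namespace LD

/-- the linear inequalities satisfied by all the measures of interest -/
def PP (γ : ℝ) (μ : Measure ℝ) : Prop := ∀ A, MeasurableSet A →
  (A ⊆ Ioc (1/2) 1 → μ A ≤ 2 * μ univ * volume A) ∧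
  ∀ δ : ℝ, 0 < δ → ENNReal.ofReal (δ ^ aa (1/γ-1)) * μ (Icc δ 1) * leb A ≤ μ A

lemma IsC.pp {γ : ℝ} (hγ : γ ∈ Ioo (0:ℝ) 1) {μ : Measure ℝ} (hμ : IsC γ μ) : PP γ μ :=
  fun _ hA => ⟨fun h => hμ.upper hA h, fun _ hδ => hμ.lower hγ hA hδ⟩

lemma PP.smul {γ : ℝ} {μ : Measure ℝ} (h : PP γ μ) (c : ENNReal) : PP γ (c • μ) := by
  intro A hA
  simp only [Measure.smul_apply, smul_eq_mul]
  refine ⟨fun hs => ?_, fun δ hδ => ?_⟩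
  · calc c * μ A ≤ c * (2 * μ univ * volume A) := by gcongr; exact (h A hA).1 hs
      _ = _ := by ring
  · calc _ = c * (ENNReal.ofReal (δ ^ aa (1/γ-1)) * μ (Icc δ 1) * leb A) := by ring
      _ ≤ _ := by gcongr; exact (h A hA).2 δ hδ

lemma PP.sum {γ : ℝ} {ι : Type} {μ : ι → Measure ℝ} (h : ∀ i, PP γ (μ i)) :
    PP γ (Measure.sum μ) := by
  intro A hA
  rw [Measure.sum_apply _ hA, Measure.sum_apply _ MeasurableSet.univ]
  refine ⟨fun hs => ?_, fun δ hδ => ?_⟩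
  · rw [← ENNReal.tsum_mul_left, ← ENNReal.tsum_mul_right]
    exact ENNReal.tsum_le_tsum fun i => (h i A hA).1 hs
  · rw [Measure.sum_apply _ measurableSet_Icc, ← ENNReal.tsum_mul_left, ← ENNReal.tsum_mul_right]
    exact ENNReal.tsum_le_tsum fun i => (h i A hA).2 δ hδ

lemma leb_le_one (A : Set ℝ) : leb A ≤ 1 := by
  refine (measure_mono (subset_univ A)).trans ?_
  simp [leb]

instance leb_prob : IsProbabilityMeasure leb := ⟨by simp [leb]⟩

lemma PP.limit {γ : ℝ} {ν : Measure ℝ} [IsFiniteMeasure ν]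
    (h : ∀ ε : NNReal, 0 < ε → ∃ μ, PP γ μ ∧ ∀ B, MeasurableSet B →
      μ B ≤ ν B + ε ∧ ν B ≤ μ B + ε) : PP γ ν := by
  intro A hA
  refine ⟨fun hs => ?_, fun δ hδ => ?_⟩
  · have hv : volume A ≤ 1 := (measure_mono hs).trans (by simp)
    apply ENNReal.le_of_forall_pos_le_add
    intro ε hε _
    obtain ⟨μ, hμ, hc⟩ := h (ε/3) (by positivity)
    calc ν A ≤ μ A + (ε/3 : NNReal) := (hc A hA).2
      _ ≤ 2 * μ univ * volume A + (ε/3 : NNReal) := by gcongr; exact (hμ A hA).1 hs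
      _ ≤ 2 * (ν univ + (ε/3 : NNReal)) * volume A + (ε/3 : NNReal) := by
          gcongr; exact (hc univ MeasurableSet.univ).1
      _ = 2 * ν univ * volume A + (2 * (ε/3 : NNReal) * volume A + (ε/3 : NNReal)) := by ring
      _ ≤ 2 * ν univ * volume A + (2 * (ε/3 : NNReal) * 1 + (ε/3 : NNReal)) := by gcongr
      _ = 2 * ν univ * volume A + ε := by
          congr 1
          norm_cast
          apply NNReal.coe_injective; push_cast; ring
  · apply ENNReal.le_of_forall_pos_le_add
    intro ε hε _
    set d : NNReal := Real.toNNReal (δ ^ aa (1/γ-1)) with hd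
    have hdd : ENNReal.ofReal (δ ^ aa (1/γ-1)) = d := rfl
    obtain ⟨μ, hμ, hc⟩ := h (ε/(d+1)) (by positivity)
    have h2 := (hμ A hA).2 δ hδ
    rw [hdd] at h2 ⊢
    calc (d : ENNReal) * ν (Icc δ 1) * leb A
        ≤ d * (μ (Icc δ 1) + (ε/(d+1) : NNReal)) * leb A := by
          gcongr; exact (hc _ measurableSet_Icc).2
      _ = d * μ (Icc δ 1) * leb A + d * (ε/(d+1) : NNReal) * leb A := by ring
      _ ≤ μ A + d * (ε/(d+1) : NNReal) * 1 := by gcongr; exact leb_le_one A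
      _ ≤ ν A + (ε/(d+1) : NNReal) + d * (ε/(d+1) : NNReal) * 1 := by
          gcongr; exact (hc A hA).1
      _ = ν A + ε := by
          rw [add_assoc]; congr 1
          norm_cast
          apply NNReal.coe_injective; push_cast; field_simp; ring

lemma EE_tendsto {γ : ℝ} (hγ : γ ∈ Ioo (0:ℝ) 1) : Tendsto (EE γ) atTop (nhds 0) := by
  unfold EE
  have hk := kap_pos (β := 1/γ-1)
  refine Real.tendsto_exp_neg_atTop_nhds_zero.comp (f := fun k : ℕ => kap (1/γ-1) * (k:ℝ)^γ) ?_ |>.congr ?_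
  · exact ((tendsto_rpow_atTop hγ.1).comp tendsto_natCast_atTop_atTop).const_mul_atTop hk
  · intro k; simp

lemma invariant_pp {γ : ℝ} (hγ : γ ∈ Ioo (0:ℝ) 1) {ν : Measure ℝ} [IsFiniteMeasure ν]
    (hac : ν ≪ leb) (hT : MeasurePreserving (Tmap γ) ν ν) : PP γ ν := by
  apply PP.limit
  intro ε hε
  set f : ℝ → ℝ := fun y => (ν.rnDeriv leb y).toReal with hf
  have hfi : Integrable f leb := Measure.integrable_toReal_rnDeriv
  have hε2 : ((ε/2 : NNReal) : ENNReal) ≠ 0 := by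
    have : (0:NNReal) < ε/2 := by positivity
    exact_mod_cast this.ne'
  obtain ⟨g, hgc, hgi, hgcont, -⟩ := hfi.exists_hasCompactSupport_lintegral_sub_le hε2
  have huc := hgc.uniformContinuous_of_continuous hgcont
  rw [Metric.uniformContinuous_iff] at huc
  obtain ⟨δ', hδ', hu⟩ := huc (ε/2 : NNReal) (by positivity)
  obtain ⟨n, hn⟩ := ((EE_tendsto hγ).eventually (gt_mem_nhds hδ')).exists
  classical
  set rep : List Bool → ℝ := fun w => if h : ∃ z ∈ Ioc (0:ℝ) 1, code γ n z = w then h.choose else 0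
  have hrep : ∀ y ∈ Ioc (0:ℝ) 1, |g (rep (code γ n y)) - g y| < (ε/2 : NNReal) := by
    intro y hy
    have h : ∃ z ∈ Ioc (0:ℝ) 1, code γ n z = code γ n y := ⟨y, hy, rfl⟩
    have e : rep (code γ n y) = h.choose := dif_pos h
    rw [e]
    have := hu (a := h.choose) (b := y) (by
      rw [Real.dist_eq]
      exact (code_diam hγ n h.choose_spec.1 hy h.choose_spec.2).trans_lt hn)
    rwa [Real.dist_eq] at this
  set cyl : List Bool → Set ℝ := fun w => {y | code γ n y = w} with hcyl
  have hcm : ∀ w, MeasurableSet (cyl w) := code_meas γ n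
  have hdisj : Pairwise (Function.onFun Disjoint cyl) := by
    intro w w' hne
    rw [Function.onFun, Set.disjoint_left]
    intro y h1 h2
    exact hne (h1.symm.trans h2)
  have hUn : (⋃ w, cyl w) = univ := by
    ext y; simp [hcyl]
  set G : List Bool → ENNReal := fun w => ENNReal.ofReal (g (rep w)) with hG
  refine ⟨Measure.sum fun w => G w • (leb.restrict (cyl w)).map ((Tmap γ)^[n]), ?_, ?_⟩
  · exact PP.sum fun w => ((cyl_push hγ n w (isD_leb hγ).isC).pp hγ).smul _
  intro B' hB'
  set B := ((Tmap γ)^[n]) ⁻¹' B' with hB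
  have hBm : MeasurableSet B := Tn_meas γ n hB'
  rw [Measure.sum_apply _ hB']
  have e1 : ∀ w, (G w • (leb.restrict (cyl w)).map ((Tmap γ)^[n])) B' =
      ∫⁻ y in cyl w, B.indicator (fun y => G (code γ n y)) y ∂leb := by
    intro w
    rw [Measure.smul_apply, Measure.map_apply (Tn_meas γ n) hB', smul_eq_mul,
      lintegral_indicator hBm, ← setLIntegral_const]
    rw [Measure.restrict_restrict hBm]
    refine setLIntegral_congr_fun (hBm.inter (hcm w)) ?_
    intro y hy
    have : code γ n y = w := hy.2
    simp only [this]
  simp only [e1]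
  rw [← lintegral_iUnion hcm hdisj, hUn, Measure.restrict_univ, lintegral_indicator hBm]
  have e2 : ν B' = ∫⁻ y in B, ENNReal.ofReal (f y) ∂leb := by
    rw [← (hT.iterate n).measure_preimage hB'.nullMeasurableSet]
    conv_lhs => rw [← Measure.withDensity_rnDeriv_eq ν leb hac]
    rw [withDensity_apply _ hBm]
    refine setLIntegral_congr_fun_ae hBm ?_
    filter_upwards [Measure.rnDeriv_lt_top ν leb] with y hy _
    rw [hf, ENNReal.ofReal_toReal hy.ne]
  rw [e2]
  have haeI : ∀ᵐ y ∂(leb.restrict B), y ∈ Ioc (0:ℝ) 1 :=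
    ae_restrict_of_ae (ae_restrict_mem measurableSet_Ioc)
  have hr : ∀ y, |f y - g y| = ‖f y - g y‖ := fun y => rfl
  have hintg : ∫⁻ y in B, (‖f y - g y‖ₑ + (ε/2 : NNReal)) ∂leb ≤ ε := by
    refine (setLIntegral_le_lintegral _ _).trans ?_
    rw [lintegral_add_right _ measurable_const, lintegral_const, measure_univ, mul_one]
    calc _ ≤ ((ε/2 : NNReal) : ENNReal) + (ε/2 : NNReal) := by gcongr
      _ = ε := by norm_cast; exact add_halves ε
  have hmeas : Measurable fun y => (‖f y - g y‖ₑ + ((ε/2 : NNReal) : ENNReal)) := by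
    have : Measurable f := (Measure.measurable_rnDeriv ν leb).ennreal_toReal
    have := hgcont.measurable
    fun_prop
  have conv : ∀ y, (‖f y - g y‖ₑ + ((ε/2 : NNReal) : ENNReal)) =
      ENNReal.ofReal (|f y - g y| + (ε/2 : NNReal)) := by
    intro y
    rw [ENNReal.ofReal_add (abs_nonneg _) (NNReal.coe_nonneg _), ENNReal.ofReal_coe_nnreal,
      hr, ofReal_norm]
  constructor
  · refine le_trans ?_ (add_le_add_right hintg _)
    rw [← lintegral_add_right _ hmeas]
    apply lintegral_mono_ae
    filter_upwards [haeI] with y hy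
    have hfy : 0 ≤ f y := ENNReal.toReal_nonneg
    rw [conv, ← ENNReal.ofReal_add hfy (by positivity)]
    apply ENNReal.ofReal_le_ofReal
    have h1 := hrep y hy
    rw [abs_lt] at h1
    linarith [neg_abs_le (f y - g y), h1.2]
  · refine le_trans ?_ (add_le_add_right hintg _)
    rw [← lintegral_add_right _ hmeas]
    apply lintegral_mono_ae
    filter_upwards [haeI] with y hy
    rw [conv]
    refine le_trans ?_ ENNReal.ofReal_add_le
    apply ENNReal.ofReal_le_ofReal
    have h1 := hrep y hy
    rw [abs_lt] at h1
    linarith [le_abs_self (f y - g y), h1.1]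

end LD

namespace LD

lemma ac_leb {ν : Measure ℝ} (hac : ν ≪ volume) (h : ν (Ioc 0 1)ᶜ = 0) : ν ≪ leb := by
  refine Measure.AbsolutelyContinuous.mk fun s hs h0 => ?_
  rw [leb, Measure.restrict_apply hs] at h0
  have h1 := hac h0
  rw [← nonpos_iff_eq_zero]
  calc ν s ≤ ν (s ∩ Ioc 0 1 ∪ (Ioc 0 1)ᶜ) := measure_mono fun x hx => by
        by_cases h : x ∈ Ioc (0:ℝ) 1
        · exact Or.inl ⟨hx, h⟩
        · exact Or.inr h
    _ ≤ 0 := (measure_union_le _ _).trans (by rw [h1, h, add_zero])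

lemma exists_delta {ν : Measure ℝ} (h0 : ν (Ioc 0 1)ᶜ = 0) (hne : ν univ ≠ 0) :
    ∃ δ : ℝ, 0 < δ ∧ ν (Icc δ 1) ≠ 0 := by
  by_contra! h
  apply hne
  rw [← nonpos_iff_eq_zero]
  have hz : ν (⋃ n : ℕ, Icc (1/((n:ℝ)+1)) 1) = 0 :=
    measure_iUnion_null fun n => h _ (by positivity)
  calc ν univ ≤ ν ((⋃ n : ℕ, Icc (1/((n:ℝ)+1)) 1) ∪ (Ioc 0 1)ᶜ) := measure_mono fun x _ => by
        by_cases h : x ∈ Ioc (0:ℝ) 1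
        · obtain ⟨n, hn⟩ := exists_nat_one_div_lt h.1
          exact Or.inl (mem_iUnion.2 ⟨n, hn.le, h.2⟩)
        · exact Or.inr h
    _ ≤ 0 := (measure_union_le _ _).trans (by rw [hz, h0, add_zero])

lemma leb_le {γ : ℝ} (hγ : γ ∈ Ioo (0:ℝ) 1) {ν : Measure ℝ} [IsFiniteMeasure ν]
    (hac : ν ≪ volume) (h0 : ν (Ioc 0 1)ᶜ = 0) (hT : MeasurePreserving (Tmap γ) ν ν)
    (hne : ν univ ≠ 0) : ∃ K : NNReal, ∀ A, MeasurableSet A → leb A ≤ K * ν A := by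
  obtain ⟨δ, hδ, hd⟩ := exists_delta h0 hne
  have hp := invariant_pp hγ (ac_leb hac h0) hT
  set c := ENNReal.ofReal (δ ^ aa (1/γ-1)) * ν (Icc δ 1) with hc
  have hc0 : c ≠ 0 := by
    refine mul_ne_zero ?_ hd
    have : 0 < δ ^ aa (1/γ-1) := by positivity
    simpa using this
  have hct : c ≠ ⊤ := ENNReal.mul_ne_top ENNReal.ofReal_ne_top (measure_ne_top _ _)
  refine ⟨c⁻¹.toNNReal, fun A hA => ?_⟩
  rw [ENNReal.coe_toNNReal (ENNReal.inv_ne_top.2 hc0)]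
  have := (hp A hA).2 δ hδ
  calc leb A = c⁻¹ * (c * leb A) := by
        rw [← mul_assoc, ENNReal.inv_mul_cancel hc0 hct, one_mul]
    _ ≤ _ := by gcongr

lemma isD_le {γ : ℝ} (hγ : γ ∈ Ioo (0:ℝ) 1) {ν : Measure ℝ} [IsFiniteMeasure ν]
    (hac : ν ≪ volume) (h0 : ν (Ioc 0 1)ᶜ = 0) (hT : MeasurePreserving (Tmap γ) ν ν)
    (hne : ν univ ≠ 0) : ∃ K : NNReal, (∀ A, MeasurableSet A → leb A ≤ K * ν A) ∧
    ∀ μ, IsD γ μ → μ ≤ (K * μ univ) • ν := by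
  obtain ⟨K, hK⟩ := leb_le hγ hac h0 hT hne
  refine ⟨K + Real.toNNReal (2 ^ aa (1/γ-1)) * K, fun A hA => ?_, fun μ hμ => ?_⟩
  · refine (hK A hA).trans ?_
    gcongr
    exact le_self_add
  refine Measure.le_iff.2 fun A hA => ?_
  rw [Measure.smul_apply, smul_eq_mul]
  refine (hμ.le hA).trans ?_
  have : ENNReal.ofReal (2 ^ aa (1/γ-1)) = (Real.toNNReal (2 ^ aa (1/γ-1)) : ENNReal) := rfl
  rw [this]
  calc _ ≤ (Real.toNNReal (2 ^ aa (1/γ-1)) : ENNReal) * μ univ * (K * ν A) := by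
        gcongr; exact hK A hA
    _ = ((Real.toNNReal (2 ^ aa (1/γ-1)) * K : NNReal) : ENNReal) * μ univ * ν A := by
        push_cast; ring
    _ ≤ _ := by
        gcongr
        exact le_add_self

lemma ergodic {γ : ℝ} (hγ : γ ∈ Ioo (0:ℝ) 1) {ν : Measure ℝ} [IsFiniteMeasure ν]
    (hac : ν ≪ volume) (h0 : ν (Ioc 0 1)ᶜ = 0) (hT : MeasurePreserving (Tmap γ) ν ν) :
    Ergodic (Tmap γ) ν := by
  refine ⟨hT, ⟨fun A hA hinv => ?_⟩⟩
  rw [Filter.eventuallyConst_set']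
  by_cases hz : ν A = 0
  · left
    filter_upwards [measure_eq_zero_iff_ae_notMem.1 hz] with x hx
    exact eq_false hx
  right
  set ν' := ν.restrict A with hν'
  have hT' : MeasurePreserving (Tmap γ) ν' ν' := by
    have := hT.restrict_preimage hA
    rwa [hinv] at this
  have hac' : ν' ≪ volume := Measure.restrict_le_self.absolutelyContinuous.trans hac
  have h0' : ν' (Ioc 0 1)ᶜ = 0 := Measure.restrict_le_self.absolutelyContinuous h0
  obtain ⟨K, hK⟩ := leb_le hγ hac' h0' hT' (by rwa [hν', Measure.restrict_apply_univ])
  have h1 := hK Aᶜ hA.compl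
  rw [hν', Measure.restrict_apply hA.compl, compl_inter_self, measure_empty, mul_zero,
    nonpos_iff_eq_zero] at h1
  have h2 := ac_leb hac h0 h1
  rw [measure_eq_zero_iff_ae_notMem] at h2
  filter_upwards [h2] with x hx
  have : x ∈ A := by simpa using hx
  exact eq_true this

lemma mean_ergodic {γ : ℝ} {ν : Measure ℝ} [IsProbabilityMeasure ν]
    (hE : Ergodic (Tmap γ) ν) {φ : ℝ → ℝ} (hφ : Measurable φ) {M : ℝ} (hM : ∀ x, |φ x| ≤ M)
    (hmean : ∫ x, φ x ∂ν = 0) :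
    Tendsto (fun n : ℕ => (n:ℝ)⁻¹ * ∫ y, |SS γ φ n y| ∂ν) atTop (nhds 0) := by
  have hT := hE.toMeasurePreserving
  have hbd : MemLp φ 2 ν := MemLp.of_bound hφ.aestronglyMeasurable M (ae_of_all _ hM)
  set x : Lp ℝ 2 ν := hbd.toLp φ with hx
  set F : Lp ℝ 2 ν →L[ℝ] Lp ℝ 2 ν :=
    (Lp.compMeasurePreservingₗᵢ ℝ (Tmap γ) hT).toContinuousLinearMap with hF
  have hF1 : ‖F‖ ≤ 1 := LinearIsometry.norm_toContinuousLinearMap_le _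
  have key := F.tendsto_birkhoffAverage_orthogonalProjection hF1 x
  set p := (F.eqLocus (1 : Lp ℝ 2 ν →L[ℝ] Lp ℝ 2 ν)).orthogonalProjectionOnto x with hp
  have hFa : ∀ z, F z = Lp.compMeasurePreserving (Tmap γ) hT z := fun z => rfl
  have hpfix : F p = p := p.2
  obtain ⟨c, hc⟩ : ∃ c : ℝ, ((p : Lp ℝ 2 ν) : ℝ → ℝ) =ᵐ[ν] Function.const ℝ c := by
    apply hE.ae_eq_const_of_ae_eq_comp_ae (Lp.aestronglyMeasurable _)
    have h1 := Lp.coeFn_compMeasurePreserving (p : Lp ℝ 2 ν) hT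
    rw [← hFa, hpfix] at h1
    exact h1.symm
  have hone : MemLp (fun _ : ℝ => (1:ℝ)) 2 ν := memLp_const 1
  set u : Lp ℝ 2 ν := hone.toLp _ with hu
  have huF : u ∈ F.eqLocus (1 : Lp ℝ 2 ν →L[ℝ] Lp ℝ 2 ν) := by
    change F u = u
    rw [hFa, hu, Lp.toLp_compMeasurePreserving]
    rfl
  have hinner : inner ℝ u x = inner ℝ u (p : Lp ℝ 2 ν) := by
    have := Submodule.inner_orthogonalProjectionOnto_eq_of_mem_left ⟨u, huF⟩ x
    exact this.symm
  have e1 : inner ℝ u x = ∫ y, φ y ∂ν := by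
    rw [L2.inner_def]
    apply integral_congr_ae
    filter_upwards [hone.coeFn_toLp, hbd.coeFn_toLp] with y h1 h2
    rw [hu, h1, hx, h2]; simp
  have e2 : inner ℝ u (p : Lp ℝ 2 ν) = c := by
    rw [L2.inner_def]
    rw [integral_congr_ae (g := fun _ => c)]
    · simp
    filter_upwards [hone.coeFn_toLp, hc] with y h1 h2
    rw [hu, h1, h2]; simp
  have hc0 : c = 0 := by rw [← e2, ← hinner, e1, hmean]
  have hp0 : (p : Lp ℝ 2 ν) = 0 := by
    apply Lp.ext
    filter_upwards [hc, Lp.coeFn_zero ℝ 2 ν] with y h1 h2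
    rw [h1, h2, hc0]; rfl
  rw [hp0] at key
  have key2 := key.norm
  rw [norm_zero] at key2
  refine squeeze_zero (fun n => ?_) (fun n => ?_) key2
  · exact mul_nonneg (by positivity) (integral_nonneg fun _ => abs_nonneg _)
  have hSm := SS_meas (γ := γ) hφ n
  have hS : MemLp (SS γ φ n) 2 ν := MemLp.of_bound hSm.aestronglyMeasurable (M*n)
    (ae_of_all _ (SS_bound hM n))
  have e3 : birkhoffAverage ℝ F id n x = (n:ℝ)⁻¹ • hS.toLp _ := by
    rw [birkhoffAverage, birkhoffSum]
    congr 1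
    have : ∀ k, F^[k] x = ((hbd.comp_measurePreserving (hT.iterate k)).toLp _) := by
      intro k
      have h1 : F^[k] = (Lp.compMeasurePreserving (E := ℝ) (p := 2) (Tmap γ) hT)^[k] := rfl
      rw [h1, Lp.compMeasurePreserving_iterate, hx, Lp.toLp_compMeasurePreserving]
    simp only [id, this]
    apply Lp.ext
    have hsum := Lp.coeFn_finsetSum (Finset.range n)
      (fun k => (hbd.comp_measurePreserving (hT.iterate k)).toLp _)
    filter_upwards [hS.coeFn_toLp, hsum,
      ae_all_iff.2 fun k => (hbd.comp_measurePreserving (hT.iterate k)).coeFn_toLp] with y h1 h2 h3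
    rw [h1, h2, Finset.sum_apply]
    simp only [h3]; rfl
  rw [e3, norm_smul, Lp.norm_toLp, norm_inv, Real.norm_natCast]
  gcongr
  have : ∫ y, |SS γ φ n y| ∂ν = (eLpNorm (SS γ φ n) 1 ν).toReal := by
    rw [eLpNorm_one_eq_lintegral_enorm]
    exact integral_norm_eq_lintegral_enorm hSm.aestronglyMeasurable
  rw [this]
  apply ENNReal.toReal_mono hS.eLpNorm_lt_top.ne
  exact eLpNorm_le_eLpNorm_of_exponent_le (by norm_num) hSm.aestronglyMeasurable

end LD

namespace LD

lemma sum_exp {γ c : ℝ} (hγ : 0 < γ) (hc : 0 < c) (p : ℝ) :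
    Summable fun k : ℕ => (k:ℝ) ^ p * Real.exp (-c * (k:ℝ) ^ γ) := by
  have h1 := isLittleO_exp_neg_mul_rpow_atTop hc ((-2-p)/γ)
  have h2 : Tendsto (fun k : ℕ => (k:ℝ) ^ γ) atTop atTop :=
    (tendsto_rpow_atTop hγ).comp tendsto_natCast_atTop_atTop
  have h3 := (h1.comp_tendsto h2).isBigO
  have h4 := (Asymptotics.isBigO_refl (fun k : ℕ => (k:ℝ) ^ p) atTop).mul h3
  have h5 : Summable fun k : ℕ => (k:ℝ) ^ (-2:ℝ) := Real.summable_nat_rpow.2 (by norm_num)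
  refine summable_of_isBigO_nat h5 (h4.congr' (EventuallyEq.rfl) ?_)
  filter_upwards [eventually_gt_atTop 0] with k hk
  have hk' : (0:ℝ) < k := by exact_mod_cast hk
  simp only [Function.comp]
  rw [← Real.rpow_mul hk'.le, ← Real.rpow_add hk']
  congr 1
  field_simp; ring

lemma sum_exp0 {γ c : ℝ} (hγ : 0 < γ) (hc : 0 < c) :
    Summable fun k : ℕ => Real.exp (-c * (k:ℝ) ^ γ) := by
  simpa using sum_exp hγ hc 0

lemma sum_EE {γ : ℝ} (hγ : γ ∈ Ioo (0:ℝ) 1) {η : ℝ} (hη : 0 < η) :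
    Summable fun k => EE γ k ^ η := by
  have hk := kap_pos (β := 1/γ-1)
  refine (sum_exp0 hγ.1 (mul_pos hk hη)).congr fun k => ?_
  unfold EE
  rw [← Real.exp_mul]; congr 1; ring

lemma NN_step {γ : ℝ} (hγ : γ ∈ Ioo (0:ℝ) 1) {ν : Measure ℝ} [IsProbabilityMeasure ν]
    (hac : ν ≪ volume) (h0 : ν (Ioc 0 1)ᶜ = 0) (hT : MeasurePreserving (Tmap γ) ν ν) (k : ℕ) :
    ν.real (NN γ k) ≤ ν.real (NN γ (k+1)) + EE γ k := by
  have hp := invariant_pp hγ (ac_leb hac h0) hT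
  set Y : Set ℝ := Ioc (1/2) ((1+EE γ k)/2) ∩ Ioc (1/2) 1 with hY
  have hYm : MeasurableSet Y := measurableSet_Ioc.inter measurableSet_Ioc
  have hY2 := (hp Y hYm).1 inter_subset_right
  have hY3 : volume Y ≤ ENNReal.ofReal (EE γ k / 2) := by
    refine (measure_mono inter_subset_left).trans ?_
    rw [Real.volume_Ioc]
    apply ENNReal.ofReal_le_ofReal; linarith
  have hY4 : ν Y ≤ ENNReal.ofReal (EE γ k) := by
    refine hY2.trans ?_
    rw [measure_univ, mul_one]
    calc 2 * volume Y ≤ ENNReal.ofReal 2 * ENNReal.ofReal (EE γ k / 2) := by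
          gcongr; simp
      _ = _ := by rw [← ENNReal.ofReal_mul (by norm_num)]; congr 1; ring
  have hle : ν (NN γ k) ≤ ν (NN γ (k+1)) + ν Y := by
    rw [← hT.measure_preimage (NN_meas γ k).nullMeasurableSet]
    calc ν (Tmap γ ⁻¹' NN γ k) ≤ ν (NN γ (k+1) ∪ Y ∪ (Ioc 0 1)ᶜ) := by
          apply measure_mono
          intro y hy
          by_cases hI : y ∈ Ioc (0:ℝ) 1
          · left
            by_cases h : y ≤ 1/2
            · left; exact (NN_succ hγ k y hI).2 ⟨h, hy⟩
            · right
              push Not at h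
              have h1 := NN_le hγ k hy
              rw [T_right h] at h1
              exact ⟨⟨h, by linarith⟩, h, hI.2⟩
          · right; exact hI
      _ ≤ ν (NN γ (k+1)) + ν Y + 0 := by
          refine (measure_union_le _ _).trans ?_
          rw [h0]; gcongr; exact measure_union_le _ _
      _ = _ := by rw [add_zero]
  have := ENNReal.toReal_mono (by finiteness) (hle.trans (add_le_add_right hY4 _))
  rw [ENNReal.toReal_add (by finiteness) (by finiteness), ENNReal.toReal_ofReal EE_pos.le] at this
  exact this

lemma NN_tendsto {γ : ℝ} (hγ : γ ∈ Ioo (0:ℝ) 1) {ν : Measure ℝ} [IsProbabilityMeasure ν] :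
    Tendsto (fun k => ν.real (NN γ k)) atTop (nhds 0) := by
  have h := tendsto_measure_iInter_atTop (μ := ν) (s := NN γ)
    (fun k => (NN_meas γ k).nullMeasurableSet) (NN_anti γ) ⟨0, by finiteness⟩
  have he : (⋂ k, NN γ k) = ∅ := by
    ext y
    simp only [mem_iInter, mem_empty_iff_false, iff_false]
    intro hy
    have h1 : y ≤ 0 := ge_of_tendsto' (EE_tendsto hγ) fun k => NN_le hγ k (hy k)
    linarith [(hy 0).1.1]
  rw [he, measure_empty] at h
  exact (ENNReal.tendsto_toReal (by simp)).comp h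

lemma NN_tail {γ : ℝ} (hγ : γ ∈ Ioo (0:ℝ) 1) {ν : Measure ℝ} [IsProbabilityMeasure ν]
    (hac : ν ≪ volume) (h0 : ν (Ioc 0 1)ᶜ = 0) (hT : MeasurePreserving (Tmap γ) ν ν) :
    ∃ C > 0, ∀ k : ℕ, ν.real (NN γ k) ≤ C * Real.exp (-(kap (1/γ-1)/2) * (k:ℝ) ^ γ) := by
  have hk := kap_pos (β := 1/γ-1)
  set κ := kap (1/γ-1)/2 with hκ
  have hκ0 : 0 < κ := by positivity
  have hs := sum_exp0 hγ.1 hκ0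
  refine ⟨∑' i : ℕ, Real.exp (-κ * (i:ℝ) ^ γ), hs.tsum_pos (fun _ => (Real.exp_pos _).le) 0 (Real.exp_pos _), fun k => ?_⟩
  have hstep : ∀ j, ν.real (NN γ k) ≤ ν.real (NN γ (k+j)) + ∑ i ∈ Finset.range j, EE γ (k+i) := by
    intro j
    induction j with
    | zero => simp
    | succ j ih =>
      rw [Finset.sum_range_succ]
      have := NN_step hγ hac h0 hT (k+j)
      rw [show k + (j+1) = k+j+1 from rfl]
      linarith
  have hb : ∀ i, EE γ (k+i) ≤ Real.exp (-κ * (i:ℝ)^γ) * Real.exp (-κ * (k:ℝ)^γ) := by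
    intro i
    unfold EE
    rw [← Real.exp_add, Real.exp_le_exp]
    have e : kap (1/γ-1) = 2*κ := by rw [hκ]; ring
    rw [e]
    have h1 : (i:ℝ)^γ ≤ ((k+i:ℕ):ℝ)^γ := by
      apply Real.rpow_le_rpow (by positivity) _ hγ.1.le
      push_cast; linarith [(Nat.cast_nonneg k : (0:ℝ) ≤ k)]
    have h2 : (k:ℝ)^γ ≤ ((k+i:ℕ):ℝ)^γ := by
      apply Real.rpow_le_rpow (by positivity) _ hγ.1.le
      push_cast; linarith [(Nat.cast_nonneg i : (0:ℝ) ≤ i)]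
    nlinarith
  have hfin : ∀ j, ν.real (NN γ k) ≤ ν.real (NN γ (k+j)) +
      (∑' i : ℕ, Real.exp (-κ * (i:ℝ) ^ γ)) * Real.exp (-κ * (k:ℝ)^γ) := by
    intro j
    refine (hstep j).trans ?_
    gcongr
    refine (Finset.sum_le_sum fun i _ => hb i).trans ?_
    rw [← Finset.sum_mul]
    gcongr
    exact hs.sum_le_tsum _ fun i _ => (Real.exp_pos _).le
  have hl : Tendsto (fun j => ν.real (NN γ (k+j)) +
      (∑' i : ℕ, Real.exp (-κ * (i:ℝ) ^ γ)) * Real.exp (-κ * (k:ℝ)^γ)) atTop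
      (nhds (0 + (∑' i : ℕ, Real.exp (-κ * (i:ℝ) ^ γ)) * Real.exp (-κ * (k:ℝ)^γ))) := by
    refine Tendsto.add_const _ ?_
    exact ((NN_tendsto (ν := ν) hγ).comp (tendsto_add_atTop_nat k)).congr fun j => by
      simp [add_comm]
  have := ge_of_tendsto' hl hfin
  linarith

open Classical in
/-- number of `k < L` with `z ∈ NN k` -/
noncomputable def rr (γ : ℝ) (L : ℕ) (z : ℝ) : ℕ :=
  ∑ k ∈ Finset.range L, if z ∈ NN γ k then 1 else 0

lemma rr_meas (γ : ℝ) (L : ℕ) : Measurable (rr γ L) := by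
  classical
  unfold rr
  refine Finset.measurable_sum _ fun k _ => ?_
  exact Measurable.ite (NN_meas γ k) measurable_const measurable_const

lemma rr_le (γ : ℝ) (L : ℕ) (z : ℝ) : rr γ L z ≤ L := by
  classical
  unfold rr
  refine (Finset.sum_le_sum (g := fun _ => 1) fun k _ => ?_).trans (by simp)
  split_ifs <;> simp

lemma rr_full {γ : ℝ} {L : ℕ} {z : ℝ} (h : ∀ k < L, z ∈ NN γ k) : rr γ L z = L := by
  classical
  unfold rr
  rw [Finset.sum_congr rfl (g := fun _ => 1)]
  · simp
  · intro k hk; rw [if_pos (h k (Finset.mem_range.1 hk))]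

lemma rr_succ {γ : ℝ} {L : ℕ} {z : ℝ} (h : z ∉ NN γ L) : rr γ (L+1) z = rr γ L z := by
  classical
  unfold rr
  rw [Finset.sum_range_succ, if_neg h, add_zero]

lemma rr_mem {γ : ℝ} (L : ℕ) {z : ℝ} : rr γ L z = 0 ∨ z ∈ NN γ (rr γ L z - 1) := by
  induction L with
  | zero => left; simp [rr]
  | succ L ih =>
    by_cases h : z ∈ NN γ L
    · right
      rw [rr_full fun k hk => NN_anti γ (by omega) h]
      simpa using h
    · rw [rr_succ h]; exact ih

lemma rr_eq {γ : ℝ} {L i : ℕ} {z : ℝ} (hi : i < L) (h : z ∈ NN γ i) (h' : z ∉ NN γ (i+1)) :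
    rr γ L z = i+1 := by
  induction L with
  | zero => omega
  | succ L ih =>
    by_cases e : i = L
    · subst e
      exact rr_full fun k hk => NN_anti γ (by omega) h
    · rw [rr_succ fun hz => h' (NN_anti γ (by omega) hz)]
      exact ih (by omega)

open Classical in
/-- bound of the expectation of a function of `rr` -/
lemma rr_int {γ : ℝ} {ν : Measure ℝ} [IsProbabilityMeasure ν] {t : ℕ → ℝ}
    (ht : ∀ k, ν.real (NN γ k) ≤ t k) {F : ℕ → ℝ} (hF : ∀ k, 0 ≤ F k)
    (hs : Summable fun k => F (k+1) * t k) (L : ℕ) :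
    ∫ z, F (rr γ L z) ∂ν ≤ F 0 + ∑' k, F (k+1) * t k := by
  have hp : ∀ z, F (rr γ L z) ≤ F 0 + ∑ k ∈ Finset.range L, (NN γ k).indicator (fun _ => F (k+1)) z := by
    intro z
    have hn : ∀ k ∈ Finset.range L, 0 ≤ (NN γ k).indicator (fun _ => F (k+1)) z :=
      fun k _ => indicator_nonneg (fun _ _ => hF _) _
    rcases rr_mem (γ := γ) L (z := z) with h | h
    · rw [h]; linarith [Finset.sum_nonneg hn]
    · by_cases h0 : rr γ L z = 0
      · rw [h0]; linarith [Finset.sum_nonneg hn]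
      have hle := rr_le γ L z
      have := Finset.single_le_sum hn (Finset.mem_range.2 (show rr γ L z - 1 < L by omega))
      rw [indicator_of_mem h, Nat.sub_add_cancel (by omega)] at this
      linarith [hF 0]
  have hintg : ∀ k ∈ Finset.range L, Integrable ((NN γ k).indicator (fun _ => F (k+1))) ν :=
    fun k _ => (integrable_const _).indicator (NN_meas γ k)
  calc ∫ z, F (rr γ L z) ∂ν ≤ ∫ z, (F 0 + ∑ k ∈ Finset.range L, (NN γ k).indicator (fun _ => F (k+1)) z) ∂ν := by
        apply integral_mono_of_nonneg (ae_of_all _ fun _ => hF _) _ (ae_of_all _ hp)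
        exact (integrable_const _).add (integrable_finsetSum _ hintg)
    _ = F 0 + ∑ k ∈ Finset.range L, ν.real (NN γ k) * F (k+1) := by
        rw [integral_add (integrable_const _) (integrable_finsetSum _ hintg),
          integral_finsetSum _ hintg]
        simp [integral_indicator_const _ (NN_meas γ _)]
    _ ≤ F 0 + ∑ k ∈ Finset.range L, F (k+1) * t k := by
        refine add_le_add le_rfl (Finset.sum_le_sum fun k _ => ?_)
        rw [mul_comm]
        exact mul_le_mul_of_nonneg_left (ht k) (hF _)
    _ ≤ _ := by
        gcongr
        exact hs.sum_le_tsum _ fun k _ => mul_nonneg (hF _) (measureReal_nonneg.trans (ht k))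

end LD

namespace LD

lemma exp_second (t : ℝ) : Real.exp t ≤ 1 + t + t^2 * Real.exp |t| := by
  have h := Complex.norm_exp_sub_sum_le_norm_mul_exp (t:ℂ) 2
  have e : Complex.exp (t:ℂ) - ∑ m ∈ Finset.range 2, (t:ℂ)^m / (m.factorial : ℂ) =
      ((Real.exp t - (1+t) : ℝ) : ℂ) := by
    simp [Finset.sum_range_succ]
  rw [e, Complex.norm_real, Complex.norm_real, Real.norm_eq_abs, Real.norm_eq_abs, sq_abs] at h
  linarith [le_abs_self (Real.exp t - (1+t))]

/-- the function of `rr` appearing in the second order term -/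
noncomputable def FF (γ κ B M : ℝ) (k : ℕ) : ℝ :=
  (2*B^2 + 2*M^2*(k:ℝ)^2) * Real.exp (κ/2 * (k:ℝ)^γ)

lemma FF_nonneg {γ κ B M : ℝ} (k : ℕ) : 0 ≤ FF γ κ B M k := by unfold FF; positivity

lemma FF_sum {γ κ B M : ℝ} (hγ : γ ∈ Ioo (0:ℝ) 1) (hκ : 0 < κ) (C : ℝ) :
    Summable fun k : ℕ => FF γ κ B M (k+1) * (C * Real.exp (-κ * (k:ℝ)^γ)) := by
  have s2 := (sum_exp hγ.1 (half_pos hκ) 2).mul_left (4*M^2)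
  have s0 := (sum_exp0 hγ.1 (half_pos hκ)).mul_left (2*B^2+4*M^2)
  have s := ((s2.add s0).mul_left (Real.exp (κ/2)))
  have key : ∀ k : ℕ, FF γ κ B M (k+1) * Real.exp (-κ * (k:ℝ)^γ) ≤
      Real.exp (κ/2) * (4*M^2*((k:ℝ)^(2:ℝ) * Real.exp (-(κ/2) * (k:ℝ)^γ)) +
      (2*B^2+4*M^2) * Real.exp (-(κ/2) * (k:ℝ)^γ)) := by
    intro k
    unfold FF
    have h1 : ((k+1:ℕ):ℝ)^γ ≤ (k:ℝ)^γ + 1 := by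
      have := Real.rpow_add_le_add_rpow (Nat.cast_nonneg k : (0:ℝ) ≤ k) zero_le_one hγ.1.le hγ.2.le
      push_cast; simpa using this
    have h2 : Real.exp (κ/2 * ((k+1:ℕ):ℝ)^γ) * Real.exp (-κ * (k:ℝ)^γ) ≤
        Real.exp (κ/2) * Real.exp (-(κ/2) * (k:ℝ)^γ) := by
      rw [← Real.exp_add, ← Real.exp_add, Real.exp_le_exp]
      nlinarith
    have h3 : 2*B^2 + 2*M^2*((k+1:ℕ):ℝ)^2 ≤ 4*M^2*(k:ℝ)^2 + (2*B^2+4*M^2) := by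
      push_cast; nlinarith [mul_nonneg (sq_nonneg M) (sq_nonneg ((k:ℝ)-1))]
    have e : (k:ℝ)^(2:ℝ) = (k:ℝ)^2 := by norm_cast
    rw [e]
    calc _ = (2*B^2 + 2*M^2*((k+1:ℕ):ℝ)^2) * (Real.exp (κ/2 * ((k+1:ℕ):ℝ)^γ) * Real.exp (-κ * (k:ℝ)^γ)) := by ring
      _ ≤ (4*M^2*(k:ℝ)^2 + (2*B^2+4*M^2)) * (Real.exp (κ/2) * Real.exp (-(κ/2) * (k:ℝ)^γ)) := by
          gcongr
      _ = _ := by ring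
  have := (Summable.of_nonneg_of_le (fun k => mul_nonneg (FF_nonneg _) (Real.exp_pos _).le) key s).mul_left C
  exact this.congr fun k => by ring

set_option maxHeartbeats 2000000 in
lemma pre_H {γ : ℝ} (hγ : γ ∈ Ioo (0:ℝ) 1) {ν : Measure ℝ} [IsProbabilityMeasure ν]
    (hac : ν ≪ volume) (h0 : ν (Ioc 0 1)ᶜ = 0) (hT : MeasurePreserving (Tmap γ) ν ν)
    {φ : ℝ → ℝ} (hφ : Measurable φ) {M : ℝ} (hM1 : 1 ≤ M) (hM : ∀ x, |φ x| ≤ M)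
    (hmean : ∫ x, φ x ∂ν = 0) {CH : ℝ} (hCH : 0 ≤ CH) {ε : ℝ} (hε : 0 < ε) :
    ∃ b : ℕ, ∃ l0 : ℝ, 0 < l0 ∧ ∀ l : ℝ, 0 < l → l ≤ l0 → ∀ L : ℕ,
      (∀ r : ℕ, r ≤ L → M * (l * r) ≤ (kap (1/γ-1)/2)/2 * (r:ℝ)^γ) → ∀ μ, IsD γ μ →
      ∫⁻ y, ENNReal.ofReal (Real.exp (l * (SS γ φ b y + M * rr γ L ((Tmap γ)^[b] y)
        - ε * b + CH))) ∂μ ≤ μ univ := by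
  obtain ⟨K, -, hK⟩ := isD_le hγ hac h0 hT (by simp)
  obtain ⟨C, hC0, htail⟩ := NN_tail hγ hac h0 hT
  have hkap := kap_pos (β := 1/γ-1)
  set κ := kap (1/γ-1)/2 with hκd
  have hκ : 0 < κ := by positivity
  -- expectation of rr
  have hsR : Summable fun k : ℕ => (((k+1:ℕ):ℝ)) * (C * Real.exp (-κ * (k:ℝ)^γ)) := by
    have s1 := (sum_exp hγ.1 hκ 1).add (sum_exp0 hγ.1 hκ)
    refine (s1.mul_left C).congr fun k => ?_
    rw [Real.rpow_one]; push_cast; ring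
  set R := ∑' k : ℕ, (((k+1:ℕ):ℝ)) * (C * Real.exp (-κ * (k:ℝ)^γ)) with hR
  have hR0 : 0 ≤ R := tsum_nonneg fun k => by positivity
  -- choose b
  have hE := ergodic hγ hac h0 hT
  have hme := mean_ergodic hE hφ hM hmean
  have ev1 : ∀ᶠ b : ℕ in atTop, (b:ℝ)⁻¹ * ∫ y, |SS γ φ b y| ∂ν < ε/(4*(K+1)) :=
    hme.eventually (gt_mem_nhds (by positivity))
  have ev2 : ∀ᶠ b : ℕ in atTop, (K * (M * R) + CH) * (4/ε) ≤ b :=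
    tendsto_natCast_atTop_atTop.eventually_ge_atTop _
  obtain ⟨b, hb1, hb2, hb0⟩ := (ev1.and (ev2.and (eventually_gt_atTop 0))).exists
  have hbp : (0:ℝ) < b := by exact_mod_cast hb0
  set I1 := ∫ y, |SS γ φ b y| ∂ν with hI1
  have hI1n : 0 ≤ I1 := integral_nonneg fun _ => abs_nonneg _
  have hb1' : K * I1 ≤ ε * b / 4 := by
    rw [inv_mul_lt_iff₀ hbp] at hb1
    have hK1 : (0:ℝ) < K + 1 := by positivity
    have : (K+1) * I1 ≤ ε * b/4 := by
      calc (K+1) * I1 ≤ (K+1) * (b * (ε/(4*(K+1)))) := by gcongr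
        _ = ε * b/4 := by field_simp
    nlinarith
  have hb2' : K * (M * R) + CH ≤ ε * b / 4 := by
    have : (K * (M * R) + CH) * (4/ε) * (ε/4) ≤ b * (ε/4) := by gcongr
    have e : (K * (M * R) + CH) * (4/ε) * (ε/4) = K * (M * R) + CH := by field_simp
    linarith
  set B : ℝ := M * b + ε * b + CH with hB
  have hB0 : 0 ≤ B := by positivity
  set F := FF γ κ B M with hF
  have hsF := FF_sum (B := B) (M := M) hγ hκ C
  set FT := F 0 + ∑' k : ℕ, F (k+1) * (C * Real.exp (-κ * (k:ℝ)^γ)) with hFT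
  have hFT0 : 0 ≤ FT := add_nonneg (FF_nonneg _) (tsum_nonneg fun k =>
    mul_nonneg (FF_nonneg _) (by positivity))
  set D := K * (Real.exp B * FT) with hD
  have hD0 : 0 ≤ D := by positivity
  refine ⟨b, min 1 (ε * b / (2 * (D+1))), by positivity, ?_⟩
  intro l hl hl0 L hL μ hμ
  have hl1 : l ≤ 1 := hl0.trans (min_le_left _ _)
  have hl2 : l * D ≤ ε * b/2 := by
    have h1 : l ≤ ε * b / (2 * (D+1)) := hl0.trans (min_le_right _ _)
    rw [le_div_iff₀ (by positivity)] at h1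
    nlinarith
  have hfin := hμ.finite
  set r : ℝ → ℝ := fun y => (rr γ L ((Tmap γ)^[b] y) : ℝ) with hr
  have hrm0 : Measurable fun y => rr γ L ((Tmap γ)^[b] y) := (rr_meas γ L).comp (Tn_meas γ b)
  have hrm : Measurable r := (measurable_from_top (f := fun n : ℕ => (n:ℝ))).comp hrm0
  have hSm := SS_meas (γ := γ) hφ b
  set X : ℝ → ℝ := fun y => SS γ φ b y + M * r y - ε * b + CH with hX
  have hXm : Measurable X := by fun_prop
  have hr0 : ∀ y, 0 ≤ r y := fun y => Nat.cast_nonneg _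
  have hXb : ∀ y, |X y| ≤ B + M * r y := by
    intro y
    have h1 := SS_bound (γ := γ) hM b y
    rw [abs_le] at h1 ⊢
    have h3 : 0 ≤ M * r y := mul_nonneg (by linarith) (hr0 y)
    have h4 : 0 < ε * b := by positivity
    constructor <;> simp only [hX, hB] <;> linarith [h1.1, h1.2]
  set g : ℝ → ℝ := fun y => l * |SS γ φ b y| + l * M * r y +
    l^2 * Real.exp B * F (rr γ L ((Tmap γ)^[b] y)) with hg
  have hpt : ∀ y, Real.exp (l * X y) ≤ (1 + l * (CH - ε * b)) + g y := by
    intro y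
    have h1 := exp_second (l * X y)
    have h2 : l * X y ≤ l * (CH - ε*b) + l * |SS γ φ b y| + l * M * r y := by
      have := le_abs_self (SS γ φ b y)
      simp only [hX]
      nlinarith
    have h3 : (l * X y)^2 ≤ l^2 * (2*B^2 + 2*M^2*(r y)^2) := by
      rw [mul_pow]
      gcongr
      rw [← sq_abs (X y)]
      calc |X y|^2 ≤ (B + M * r y)^2 := by gcongr; exact hXb y
        _ ≤ _ := by nlinarith [sq_nonneg (B - M * r y)]
    have h4 : Real.exp |l * X y| ≤ Real.exp B * Real.exp (κ/2 * (r y)^γ) := by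
      rw [← Real.exp_add, Real.exp_le_exp, abs_mul, abs_of_pos hl]
      have h5 := hL _ (rr_le γ L ((Tmap γ)^[b] y))
      calc l * |X y| ≤ l * (B + M * r y) := by gcongr; exact hXb y
        _ = l * B + M * (l * r y) := by ring
        _ ≤ 1 * B + κ/2 * (r y)^γ := by gcongr
        _ = _ := by ring
    have h6 : (l * X y)^2 * Real.exp |l * X y| ≤
        l^2 * (2*B^2 + 2*M^2*(r y)^2) * (Real.exp B * Real.exp (κ/2 * (r y)^γ)) := by gcongr
    have h7 : l^2 * (2*B^2 + 2*M^2*(r y)^2) * (Real.exp B * Real.exp (κ/2 * (r y)^γ)) =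
        l^2 * Real.exp B * F (rr γ L ((Tmap γ)^[b] y)) := by
      simp only [hF, FF, hr]; ring
    simp only [hg]
    linarith
  have hg0 : ∀ y, 0 ≤ g y := by
    intro y
    have h1 := FF_nonneg (γ := γ) (κ := κ) (B := B) (M := M) (rr γ L ((Tmap γ)^[b] y))
    have h2 := hr0 y
    simp only [hg]
    positivity
  have hFm : Measurable fun y => F (rr γ L ((Tmap γ)^[b] y)) :=
    (measurable_from_top (f := F)).comp hrm0
  -- integrability against finite measures
  have bddF : ∃ c, ∀ k ≤ L, |F k| ≤ c := by
    refine ⟨∑ k ∈ Finset.range (L+1), |F k|, fun k hk => ?_⟩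
    exact Finset.single_le_sum (f := fun k => |F k|) (fun _ _ => abs_nonneg _) (Finset.mem_range.2 (by omega))
  obtain ⟨cF, hcF⟩ := bddF
  have iS : ∀ (m : Measure ℝ) [IsFiniteMeasure m], Integrable (fun y => |SS γ φ b y|) m := by
    intro m _
    refine Integrable.of_bound (C := M * b) (by fun_prop) (ae_of_all _ fun y => ?_)
    rw [Real.norm_eq_abs, abs_abs]; exact SS_bound hM b y
  have ir : ∀ (m : Measure ℝ) [IsFiniteMeasure m], Integrable r m := by
    intro m _
    refine Integrable.of_bound (C := L) (by fun_prop) (ae_of_all _ fun y => ?_)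
    rw [Real.norm_eq_abs, abs_of_nonneg (hr0 y)]
    exact Nat.cast_le.2 (rr_le γ L ((Tmap γ)^[b] y))
  have iF : ∀ (m : Measure ℝ) [IsFiniteMeasure m],
      Integrable (fun y => F (rr γ L ((Tmap γ)^[b] y))) m := by
    intro m _
    refine Integrable.of_bound (C := cF) hFm.aestronglyMeasurable (ae_of_all _ fun y => ?_)
    exact hcF _ (rr_le γ L _)
  have ig : ∀ (m : Measure ℝ) [IsFiniteMeasure m], Integrable g m := fun m _ =>
    (((iS m).const_mul l).add ((ir m).const_mul (l*M))).add ((iF m).const_mul _)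
  have hgν : ∫ y, g y ∂ν ≤ l * I1 + l * M * R + l^2 * Real.exp B * FT := by
    have e : ∫ y, g y ∂ν = l * I1 + l * M * ∫ y, r y ∂ν +
        l^2 * Real.exp B * ∫ y, F (rr γ L ((Tmap γ)^[b] y)) ∂ν := by
      have i12 : Integrable (fun y => l * |SS γ φ b y| + l * M * r y) ν :=
        ((iS ν).const_mul l).add ((ir ν).const_mul (l*M))
      simp only [hg]
      rw [integral_add i12 ((iF ν).const_mul _),
        integral_add ((iS ν).const_mul l) ((ir ν).const_mul (l*M)), integral_const_mul,
        integral_const_mul, integral_const_mul]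
    have inv : ∀ G : ℕ → ℝ, ∫ y, G (rr γ L ((Tmap γ)^[b] y)) ∂ν = ∫ z, G (rr γ L z) ∂ν := by
      intro G
      have hmap := (hT.iterate b).map_eq
      have hGm : Measurable fun z => G (rr γ L z) := (measurable_from_top (f := G)).comp (rr_meas γ L)
      conv_rhs => rw [← hmap]
      rw [integral_map (Tn_meas γ b).aemeasurable hGm.aestronglyMeasurable]
    have h1 : ∫ y, r y ∂ν ≤ R := by
      have := rr_int htail (F := fun k : ℕ => (k:ℝ)) (fun k => Nat.cast_nonneg k) hsR L
      rw [← inv (fun k : ℕ => (k:ℝ))] at this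
      simpa [hR] using this
    have h2 : ∫ y, F (rr γ L ((Tmap γ)^[b] y)) ∂ν ≤ FT := by
      rw [inv F]; exact rr_int htail (fun k => FF_nonneg k) hsF L
    rw [e]
    gcongr
  have hgμ : ∫ y, g y ∂μ ≤ K * μ.real univ * ∫ y, g y ∂ν := by
    have hc : (K * μ univ : ENNReal) ≠ ⊤ := by finiteness
    have : IsFiniteMeasure ((K * μ univ : ENNReal) • ν) := ν.smul_finite hc
    calc ∫ y, g y ∂μ ≤ ∫ y, g y ∂((K * μ univ : ENNReal) • ν) :=
          integral_mono_measure (hK μ hμ) (ae_of_all _ hg0) (ig _)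
      _ = _ := by
          rw [integral_smul_measure, ENNReal.toReal_mul, smul_eq_mul]; rfl
  have hm0 : 0 ≤ μ.real univ := measureReal_nonneg
  have ie : Integrable (fun y => Real.exp (l * X y)) μ := by
    refine Integrable.mono' (((integrable_const (1 + l * (CH - ε * b))).add (ig μ))) (by fun_prop) (ae_of_all _ fun y => ?_)
    rw [Real.norm_eq_abs, abs_of_pos (Real.exp_pos _)]; exact hpt y
  have hmain : ∫ y, Real.exp (l * X y) ∂μ ≤ μ.real univ := by
    calc ∫ y, Real.exp (l * X y) ∂μ ≤ ∫ y, ((1 + l * (CH - ε * b)) + g y) ∂μ :=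
          integral_mono ie ((integrable_const _).add (ig μ)) hpt
      _ = μ.real univ * (1 + l * (CH - ε * b)) + ∫ y, g y ∂μ := by
          rw [integral_add (integrable_const _) (ig μ), integral_const, smul_eq_mul]
      _ ≤ μ.real univ * (1 + l * (CH - ε * b)) + K * μ.real univ *
            (l * I1 + l * M * R + l^2 * Real.exp B * FT) := by
          gcongr
          exact hgμ.trans (by gcongr)
      _ = μ.real univ * (1 + l * ((K * I1) + (K * (M * R) + CH) + l * D - ε * b)) := by
          rw [hD]; ring
      _ ≤ μ.real univ * 1 := by
          gcongr
          have : (K * I1) + (K * (M * R) + CH) + l * D - ε * b ≤ 0 := by linarith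
          nlinarith
      _ = _ := mul_one _
  rw [← ofReal_integral_eq_lintegral_ofReal ie (ae_of_all _ fun y => (Real.exp_pos _).le)]
  calc _ ≤ ENNReal.ofReal (μ.real univ) := ENNReal.ofReal_le_ofReal hmain
    _ = μ univ := ENNReal.ofReal_toReal (measure_ne_top _ _)

end LD

namespace LD

/-- first visit to `(1/2,1]` at time exactly `i` -/
def PI (γ : ℝ) (i : ℕ) : Set ℝ := NN γ i ∩ ((Tmap γ)^[i]) ⁻¹' (Ioi (1/2))

lemma PI_meas (γ : ℝ) (i : ℕ) : MeasurableSet (PI γ i) :=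
  (NN_meas γ i).inter (Tn_meas γ i measurableSet_Ioi)

lemma PI_not {γ : ℝ} {i : ℕ} {z : ℝ} (h : z ∈ PI γ i) : z ∉ NN γ (i+1) := fun hz => by
  have h1 := hz.2 i (by omega)
  have h2 : 1/2 < (Tmap γ)^[i] z := h.2
  linarith

lemma PI_disj {γ : ℝ} {i j : ℕ} {z : ℝ} (h : z ∈ PI γ i) (h' : z ∈ PI γ j) : i = j := by
  rcases lt_trichotomy i j with e | e | e
  · exact absurd (NN_anti γ (by omega) h'.1) (PI_not h)
  · exact e
  · exact absurd (NN_anti γ (by omega) h.1) (PI_not h')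

lemma PI_exists {γ : ℝ} {L : ℕ} {z : ℝ} (hz : z ∈ Ioc (0:ℝ) 1) (h : z ∉ NN γ L) :
    ∃ i < L, z ∈ PI γ i := by
  induction L with
  | zero => exact absurd ⟨hz, fun i hi => by omega⟩ h
  | succ L ih =>
    by_cases h1 : z ∈ NN γ L
    · refine ⟨L, by omega, h1, ?_⟩
      by_contra h2
      apply h
      refine ⟨hz, fun i hi => ?_⟩
      rcases Nat.lt_succ_iff_lt_or_eq.1 hi with e | e
      · exact h1.2 i e
      · subst e; exact not_lt.1 h2
    · obtain ⟨i, hi, hp⟩ := ih h1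
      exact ⟨i, by omega, hp⟩

/-- block weight -/
noncomputable def WW (γ : ℝ) (φ : ℝ → ℝ) (b : ℕ) (l θ : ℝ) (i : ℕ) : ℝ → ENNReal :=
  (((Tmap γ)^[b]) ⁻¹' (PI γ i)).indicator
    fun y => ENNReal.ofReal (Real.exp (l * SS γ φ (b+i+1) y - θ * ((b+i+1:ℕ):ℝ)))

lemma WW_meas {γ : ℝ} {φ : ℝ → ℝ} (hφ : Measurable φ) (b : ℕ) (l θ : ℝ) (i : ℕ) :
    Measurable (WW γ φ b l θ i) := by
  have := SS_meas (γ := γ) hφ (b+i+1)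
  refine Measurable.indicator (by fun_prop) (Tn_meas γ b (PI_meas γ i))

/-- good orbits -/
def GG (γ : ℝ) (L b m : ℕ) : Set ℝ := {y | ∀ i ≤ m+b, (Tmap γ)^[i] y ∉ NN γ L}

lemma GG_meas (γ : ℝ) (L b m : ℕ) : MeasurableSet (GG γ L b m) := by
  have : GG γ L b m = ⋂ i, ⋂ (_ : i ≤ m+b), ((Tmap γ)^[i]) ⁻¹' (NN γ L)ᶜ := by
    ext y; simp [GG]
  rw [this]
  exact MeasurableSet.iInter fun i => MeasurableSet.iInter fun _ => Tn_meas γ i (NN_meas γ L).compl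

noncomputable def QQ (γ : ℝ) (φ : ℝ → ℝ) (L b : ℕ) (l θ : ℝ) (m : ℕ) : ℝ → ENNReal :=
  (GG γ L b m).indicator fun y => ENNReal.ofReal (Real.exp (l * SS γ φ m y - θ * (m:ℝ)))

lemma QQ_meas {γ : ℝ} {φ : ℝ → ℝ} (hφ : Measurable φ) (L b : ℕ) (l θ : ℝ) (m : ℕ) :
    Measurable (QQ γ φ L b l θ m) := by
  have := SS_meas (γ := γ) hφ m
  exact Measurable.indicator (by fun_prop) (GG_meas γ L b m)

lemma WW_sum {γ : ℝ} {φ : ℝ → ℝ} {M : ℝ} (hM : ∀ x, |φ x| ≤ M)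
    (L b : ℕ) {l ε CH : ℝ} (hl : 0 < l) (hε : 0 < ε) (y : ℝ) :
    ∑ i ∈ Finset.range L, ENNReal.ofReal (Real.exp (l*CH)) * WW γ φ b l (l*ε) i y ≤
     ENNReal.ofReal (Real.exp (l * (SS γ φ b y + M * rr γ L ((Tmap γ)^[b] y) - ε * b + CH))) := by
  by_cases h : ∃ i < L, (Tmap γ)^[b] y ∈ PI γ i
  · obtain ⟨i, hi, hp⟩ := h
    rw [Finset.sum_eq_single_of_mem i (Finset.mem_range.2 hi)]
    · unfold WW
      rw [indicator_of_mem (by exact hp), ← ENNReal.ofReal_mul (Real.exp_pos _).le, ← Real.exp_add]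
      apply ENNReal.ofReal_le_ofReal
      rw [Real.exp_le_exp, rr_eq hi hp.1 (PI_not hp), add_assoc b i 1, SS_add]
      have h1 := SS_bound (γ := γ) hM (i+1) ((Tmap γ)^[b] y)
      have h2 := (abs_le.1 h1).2
      have h3 : l * SS γ φ (i+1) ((Tmap γ)^[b] y) ≤ l * (M * ((i+1:ℕ):ℝ)) := by gcongr
      have h4 : 0 ≤ l * ε * ((i+1:ℕ):ℝ) := by positivity
      push_cast at *
      nlinarith
    · intro j _ hj
      unfold WW
      rw [indicator_of_notMem, mul_zero]
      intro hp'
      exact hj (PI_disj hp' hp)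
  · push Not at h
    rw [Finset.sum_eq_zero]
    · exact zero_le
    · intro j hj
      unfold WW
      rw [indicator_of_notMem, mul_zero]
      exact h j (Finset.mem_range.1 hj)

lemma WW_osc {γ : ℝ} (hγ : γ ∈ Ioo (0:ℝ) 1) {φ : ℝ → ℝ} {CH : ℝ}
    (hosc : ∀ n, ∀ y ∈ Ioc (0:ℝ) 1, ∀ z ∈ Ioc (0:ℝ) 1, code γ n y = code γ n z →
      |SS γ φ (n+1) y - SS γ φ (n+1) z| ≤ CH) (b i : ℕ) {l θ : ℝ} (hl : 0 < l)
    (y : ℝ) (hy : y ∈ Ioc (0:ℝ) 1) (z : ℝ) (hz : z ∈ Ioc (0:ℝ) 1)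
    (hc : code γ (b+i) y = code γ (b+i) z)
    (hyr : 1/2 < (Tmap γ)^[b+i] y) (hzr : 1/2 < (Tmap γ)^[b+i] z) :
    WW γ φ b l θ i y ≤ ENNReal.ofReal (Real.exp (l*CH)) * WW γ φ b l θ i z := by
  unfold WW
  by_cases h : (Tmap γ)^[b] y ∈ PI γ i
  · have h' : (Tmap γ)^[b] z ∈ PI γ i := by
      refine ⟨⟨Tn_mem hγ b hz, fun k hk => ?_⟩, ?_⟩
      · have h1 := h.1.2 k hk
        rw [← Function.iterate_add_apply] at h1 ⊢
        rw [← not_lt] at h1 ⊢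
        exact fun h2 => h1 ((code_iff hc (by omega)).2 h2)
      · change 1/2 < (Tmap γ)^[i] ((Tmap γ)^[b] z)
        rwa [← Function.iterate_add_apply, add_comm i b]
    rw [indicator_of_mem (by exact h), indicator_of_mem (by exact h'),
      ← ENNReal.ofReal_mul (Real.exp_pos _).le, ← Real.exp_add]
    apply ENNReal.ofReal_le_ofReal
    rw [Real.exp_le_exp]
    have h1 := (abs_le.1 (hosc (b+i) y hy z hz hc)).2
    nlinarith
  · rw [indicator_of_notMem (by exact h)]; exact zero_le

lemma key {γ : ℝ} (hγ : γ ∈ Ioo (0:ℝ) 1) {φ : ℝ → ℝ} (hφ : Measurable φ) {M : ℝ}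
    (hM1 : 1 ≤ M) (hM : ∀ x, |φ x| ≤ M) {CH : ℝ} (hCH : 0 ≤ CH)
    (hosc : ∀ n, ∀ y ∈ Ioc (0:ℝ) 1, ∀ z ∈ Ioc (0:ℝ) 1, code γ n y = code γ n z →
      |SS γ φ (n+1) y - SS γ φ (n+1) z| ≤ CH) (b L : ℕ) {l ε : ℝ} (hl : 0 < l) (hε : 0 < ε)
    (hH : ∀ μ, IsD γ μ → ∫⁻ y, ENNReal.ofReal (Real.exp (l * (SS γ φ b y
      + M * rr γ L ((Tmap γ)^[b] y) - ε * b + CH))) ∂μ ≤ μ univ) (m : ℕ) :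
    ∀ μ, IsD γ μ → ∫⁻ y, QQ γ φ L b l (l*ε) m y ∂μ ≤
      ENNReal.ofReal (Real.exp ((l*M+l*ε)*(b+L))) * μ univ := by
  induction m using Nat.strong_induction_on with
  | _ m ih =>
  intro μ hμ
  set A := ENNReal.ofReal (Real.exp ((l*M+l*ε)*(b+L))) with hA
  set κ := ENNReal.ofReal (Real.exp (l*CH)) with hκ
  have hae : ∀ᵐ x ∂μ, x ∈ Ioc (0:ℝ) 1 := by rw [ae_iff]; exact hμ.isC.ac
  set U : ℕ → Set ℝ := fun i => ((Tmap γ)^[b]) ⁻¹' (PI γ i) with hU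
  have hUm : ∀ i, MeasurableSet (U i) := fun i => Tn_meas γ b (PI_meas γ i)
  have hQm := QQ_meas (γ := γ) hφ L b l (l*ε) m
  have hterm : ∀ i ∈ Finset.range L, ∫⁻ y, (U i).indicator (QQ γ φ L b l (l*ε) m) y ∂μ ≤
      A * κ * ∫⁻ y, WW γ φ b l (l*ε) i y ∂μ := by
    intro i hi
    rw [Finset.mem_range] at hi
    by_cases hj : b+i+1 ≤ m
    · obtain ⟨m', rfl⟩ := Nat.exists_eq_add_of_le hj
      refine le_trans ?_ (block hγ hμ (b+i) (WW_meas hφ b l (l*ε) i)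
        (QQ_meas hφ L b l (l*ε) m') (κ := κ) (A := A) ?_ ?_ (ih m' (by omega)))
      · apply lintegral_mono
        intro y
        by_cases hy : y ∈ U i
        · rw [indicator_of_mem hy]
          unfold QQ
          by_cases hG : y ∈ GG γ L b (b+i+1+m')
          · have hG' : (Tmap γ)^[b+i+1] y ∈ GG γ L b m' := by
              intro k hk
              rw [← Function.iterate_add_apply]
              exact hG _ (by omega)
            beta_reduce
            rw [indicator_of_mem hG, indicator_of_mem hG']
            unfold WW
            rw [indicator_of_mem hy, ← ENNReal.ofReal_mul (Real.exp_pos _).le, ← Real.exp_add]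
            apply ENNReal.ofReal_le_ofReal
            rw [Real.exp_le_exp, SS_add (b+i+1) m']
            push_cast
            apply le_of_eq; ring
          · rw [indicator_of_notMem hG]; exact zero_le
        · rw [indicator_of_notMem hy]; exact zero_le
      · intro y _ hy
        by_contra hn
        apply hy
        unfold WW
        apply indicator_of_notMem
        intro hp
        apply hn
        have : 1/2 < (Tmap γ)^[i] ((Tmap γ)^[b] y) := hp.2
        rwa [← Function.iterate_add_apply, add_comm i b] at this
      · exact fun y hy z hz => WW_osc hγ hosc b i hl y hy z hz
    · push Not at hj
      have hκ1 : 1 ≤ κ := by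
        rw [hκ, ← ENNReal.ofReal_one]
        apply ENNReal.ofReal_le_ofReal
        exact Real.one_le_exp (by positivity)
      calc ∫⁻ y, (U i).indicator (QQ γ φ L b l (l*ε) m) y ∂μ
          ≤ ∫⁻ y, A * WW γ φ b l (l*ε) i y ∂μ := by
            apply lintegral_mono
            intro y
            by_cases hy : y ∈ U i
            · rw [indicator_of_mem hy]
              unfold QQ
              by_cases hG : y ∈ GG γ L b m
              · rw [indicator_of_mem hG]
                unfold WW
                simp only
                rw [indicator_of_mem hy, hA, ← ENNReal.ofReal_mul (Real.exp_pos _).le, ← Real.exp_add]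
                apply ENNReal.ofReal_le_ofReal
                rw [Real.exp_le_exp]
                obtain ⟨d, hd⟩ := Nat.exists_eq_add_of_lt hj
                have hd' : b+i+1 = m + (d+1) := by omega
                rw [hd', SS_add m (d+1)]
                have h1 := (abs_le.1 (SS_bound (γ := γ) hM (d+1) ((Tmap γ)^[m] y))).1
                have h2 : ((d+1:ℕ):ℝ) ≤ b + L := by exact_mod_cast (by omega : d+1 ≤ b+L)
                have h3 : (l*M+l*ε)*((d+1:ℕ):ℝ) ≤ (l*M+l*ε)*(b+L) := by gcongr
                have h4 : l * (-(M * ((d+1:ℕ):ℝ))) ≤ l * SS γ φ (d+1) ((Tmap γ)^[m] y) := by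
                  gcongr
                push_cast at *
                nlinarith
              · rw [indicator_of_notMem hG]; exact zero_le
            · rw [indicator_of_notMem hy]; exact zero_le
        _ = A * 1 * ∫⁻ y, WW γ φ b l (l*ε) i y ∂μ := by
            rw [lintegral_const_mul _ (WW_meas hφ b l (l*ε) i), mul_one]
        _ ≤ _ := by gcongr
  calc ∫⁻ y, QQ γ φ L b l (l*ε) m y ∂μ
      ≤ ∫⁻ y, ∑ i ∈ Finset.range L, (U i).indicator (QQ γ φ L b l (l*ε) m) y ∂μ := by
        apply lintegral_mono_ae
        filter_upwards [hae] with y hy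
        by_cases hG : y ∈ GG γ L b m
        · obtain ⟨i, hi, hp⟩ := PI_exists (Tn_mem hγ b hy) (hG b (by omega))
          have := Finset.single_le_sum (f := fun i => (U i).indicator (QQ γ φ L b l (l*ε) m) y)
            (fun _ _ => zero_le) (Finset.mem_range.2 hi)
          refine le_trans ?_ this
          beta_reduce
          rw [indicator_of_mem (by exact hp)]
        · unfold QQ
          rw [indicator_of_notMem hG]; exact zero_le
    _ = ∑ i ∈ Finset.range L, ∫⁻ y, (U i).indicator (QQ γ φ L b l (l*ε) m) y ∂μ :=
        lintegral_finsetSum _ fun i _ => hQm.indicator (hUm i)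
    _ ≤ ∑ i ∈ Finset.range L, A * κ * ∫⁻ y, WW γ φ b l (l*ε) i y ∂μ := Finset.sum_le_sum hterm
    _ = A * ∫⁻ y, ∑ i ∈ Finset.range L, κ * WW γ φ b l (l*ε) i y ∂μ := by
        rw [lintegral_finsetSum _ fun i _ => (WW_meas hφ b l (l*ε) i).const_mul _, Finset.mul_sum]
        refine Finset.sum_congr rfl fun i _ => ?_
        rw [lintegral_const_mul _ (WW_meas hφ b l (l*ε) i), mul_assoc]
    _ ≤ A * μ univ := by
        gcongr
        refine le_trans (lintegral_mono fun y => ?_) (hH μ hμ)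
        exact WW_sum hM L b hl hε y

end LD

namespace LD

lemma bnd1 {γ : ℝ} (hγ : γ ∈ Ioo (0:ℝ) 1) {ν : Measure ℝ} [IsProbabilityMeasure ν]
    (hT : MeasurePreserving (Tmap γ) ν ν) {μ : Measure ℝ} (hμ : IsD γ μ) (hμ1 : μ univ ≤ 1)
    {K : NNReal} (hK : μ ≤ ((K:ENNReal) * μ univ) • ν)
    {φ : ℝ → ℝ} (hφ : Measurable φ) {M l ε t : ℝ} (b L n : ℕ)
    (hkey : ∫⁻ y, QQ γ φ L b l (l*ε) n y ∂μ ≤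
      ENNReal.ofReal (Real.exp ((l*M+l*ε)*(b+L))) * μ univ) (hl : 0 < l) :
    μ {y | t ≤ SS γ φ n y} ≤ ENNReal.ofReal ((n+b+1) * (K * ν.real (NN γ L))) +
      ENNReal.ofReal (Real.exp ((l*M+l*ε)*(b+L) - (l*t - l*ε*n))) := by
  have h0 : μ (Ioc (0:ℝ) 1)ᶜ = 0 := by
    obtain ⟨h, -, -, -, -, rfl⟩ := hμ
    apply withDensity_absolutelyContinuous
    rw [leb, Measure.restrict_apply measurableSet_Ioc.compl]
    simp
  set E := Real.exp (l*t - l*ε*n) with hE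
  have hEp : 0 < E := Real.exp_pos _
  have hsub : {y | t ≤ SS γ φ n y} ⊆ (⋃ i ∈ Finset.range (n+b+1), ((Tmap γ)^[i]) ⁻¹' (NN γ L)) ∪
      {y | ENNReal.ofReal E ≤ QQ γ φ L b l (l*ε) n y} := by
    intro y hy
    by_cases hG : y ∈ GG γ L b n
    · right
      show _ ≤ QQ γ φ L b l (l*ε) n y
      unfold QQ
      rw [indicator_of_mem hG]
      apply ENNReal.ofReal_le_ofReal
      rw [hE, Real.exp_le_exp]
      have : l * t ≤ l * SS γ φ n y := by gcongr; exact hy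
      linarith
    · left
      unfold GG at hG
      simp only [mem_ofPred_eq, not_forall, not_not] at hG
      obtain ⟨i, hi, h⟩ := hG
      simp only [mem_iUnion, Finset.mem_range]
      exact ⟨i, by omega, h⟩
  refine (measure_mono hsub).trans ((measure_union_le _ _).trans ?_)
  gcongr
  · refine (measure_biUnion_finset_le _ _).trans ?_
    have h1 : ∀ i ∈ Finset.range (n+b+1), μ (((Tmap γ)^[i]) ⁻¹' (NN γ L)) ≤
        ENNReal.ofReal (K * ν.real (NN γ L)) := by
      intro i _
      calc μ (((Tmap γ)^[i]) ⁻¹' (NN γ L)) ≤ (((K:ENNReal) * μ univ) • ν) (((Tmap γ)^[i]) ⁻¹' (NN γ L)) := hK _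
        _ = K * μ univ * ν (NN γ L) := by
          rw [Measure.smul_apply, smul_eq_mul,
            (hT.iterate i).measure_preimage (NN_meas γ L).nullMeasurableSet]
        _ ≤ K * 1 * ν (NN γ L) := by gcongr
        _ = _ := by
          rw [mul_one, ENNReal.ofReal_mul K.coe_nonneg, ofReal_measureReal]
          simp
    refine (Finset.sum_le_sum h1).trans ?_
    rw [Finset.sum_const, Finset.card_range, nsmul_eq_mul, ← ENNReal.ofReal_natCast,
      ← ENNReal.ofReal_mul (by positivity)]
    apply ENNReal.ofReal_le_ofReal
    push_cast; rfl
  · have h2 := mul_meas_ge_le_lintegral (μ := μ) (QQ_meas (γ := γ) hφ L b l (l*ε) n) (ENNReal.ofReal E)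
    have h3 : ENNReal.ofReal E * μ {y | ENNReal.ofReal E ≤ QQ γ φ L b l (l*ε) n y} ≤
        ENNReal.ofReal (Real.exp ((l*M+l*ε)*(b+L))) := by
      refine h2.trans (hkey.trans ?_)
      calc _ ≤ ENNReal.ofReal (Real.exp ((l*M+l*ε)*(b+L))) * 1 := by gcongr
        _ = _ := mul_one _
    rw [Real.exp_sub, ← hE, ENNReal.ofReal_div_of_pos hEp,
      ENNReal.le_div_iff_mul_le (Or.inl (by simpa using hEp)) (Or.inl ENNReal.ofReal_ne_top), mul_comm]
    exact h3

lemma absorb {γ a : ℝ} (hγ : 0 < γ) (ha : 0 < a) (A : ℝ) :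
    ∀ᶠ n : ℕ in atTop, A * n ≤ Real.exp (a * (n:ℝ)^γ) := by
  have h := (sum_exp hγ ha 1).tendsto_atTop_zero.const_mul A
  rw [mul_zero] at h
  filter_upwards [h.eventually_le_const one_pos] with n hn
  rw [Real.rpow_one, neg_mul, Real.exp_neg, ← mul_assoc, ← div_eq_mul_inv,
    div_le_one (Real.exp_pos _)] at hn
  exact hn

lemma lam_cond {γ κ M t : ℝ} (hγ : γ ∈ Ioo (0:ℝ) 1) (hκ : 0 < κ) (hM : 1 ≤ M) {r : ℕ}
    (hr : (r:ℝ) ≤ t) : M * (κ/(2*M) * t^(γ-1) * r) ≤ κ/2 * (r:ℝ)^γ := by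
  have hMp : 0 < M := by linarith
  have : M * (κ/(2*M) * t^(γ-1) * r) = κ/2 * (t^(γ-1) * r) := by field_simp
  rw [this]
  gcongr
  rcases Nat.eq_zero_or_pos r with h | h
  · subst h; simp [Real.zero_rpow hγ.1.ne']
  · have hr0 : (0:ℝ) < r := by exact_mod_cast h
    have h1 : t^(γ-1) ≤ (r:ℝ)^(γ-1) := Real.rpow_le_rpow_of_nonpos hr0 hr (by linarith [hγ.2])
    calc t^(γ-1) * r ≤ (r:ℝ)^(γ-1) * r := by gcongr
      _ = (r:ℝ)^γ := by rw [Real.rpow_sub_one hr0.ne']; field_simp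

lemma step1 {γ : ℝ} (hγ : γ ∈ Ioo (0:ℝ) 1) {ν : Measure ℝ} [IsProbabilityMeasure ν]
    (hac : ν ≪ volume) (h0 : ν (Ioc 0 1)ᶜ = 0) (hT : MeasurePreserving (Tmap γ) ν ν)
    {φ : ℝ → ℝ} (hφ : Measurable φ) {M : ℝ} (hM1 : 1 ≤ M) (hM : ∀ x, |φ x| ≤ M)
    (hmean : ∫ x, φ x ∂ν = 0) {CH : ℝ} (hCH : 0 ≤ CH)
    (hosc : ∀ n, ∀ y ∈ Ioc (0:ℝ) 1, ∀ z ∈ Ioc (0:ℝ) 1, code γ n y = code γ n z →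
      |SS γ φ (n+1) y - SS γ φ (n+1) z| ≤ CH) :
    ∃ c : ℝ, 0 < c ∧ ∀ x : ℝ, 0 < x → ∀ᶠ n : ℕ in atTop, ∀ μ, IsD γ μ → μ univ ≤ 1 →
      μ {y | n * x ≤ SS γ φ n y} ≤ ENNReal.ofReal (Real.exp (-c * (n*x)^γ)) := by
  obtain ⟨K, -, hK⟩ := isD_le hγ hac h0 hT (by simp)
  obtain ⟨C, hC0, htail⟩ := NN_tail hγ hac h0 hT
  have hkap := kap_pos (β := 1/γ-1)
  set κ := kap (1/γ-1)/2 with hκd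
  have hκ : 0 < κ := by positivity
  have hMp : 0 < M := by linarith
  set c1 := κ/(2*M) with hc1
  have hc1p : 0 < c1 := by positivity
  set c4 := min (κ * (1/(16*M))^γ) (c1/2) with hc4
  have hc4p : 0 < c4 := by
    apply lt_min <;> positivity
  refine ⟨c4/2, by positivity, fun x hx => ?_⟩
  set ε := min M (x/4) with hε
  have hεp : 0 < ε := lt_min hMp (by positivity)
  have hεM : ε ≤ M := min_le_left _ _
  have hεx : ε ≤ x/4 := min_le_right _ _
  obtain ⟨b, l0, hl0, hb⟩ := pre_H hγ hac h0 hT hφ hM1 hM hmean hCH hεp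
  have htt : Tendsto (fun n : ℕ => (n:ℝ) * x) atTop atTop :=
    tendsto_natCast_atTop_atTop.atTop_mul_const hx
  have hlam : Tendsto (fun n : ℕ => c1 * ((n:ℝ) * x)^(γ-1)) atTop (nhds 0) := by
    have := ((tendsto_rpow_neg_atTop (y := 1-γ) (by linarith [hγ.2])).comp htt).const_mul c1
    rw [mul_zero] at this
    refine this.congr fun n => ?_
    simp only [Function.comp]
    rw [neg_sub]
  set D := (b+2) * (K * C) + Real.exp (2*M*b) with hD
  filter_upwards [eventually_ge_atTop 1, htt.eventually_ge_atTop (16*M),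
    hlam.eventually_le_const hl0, hlam.eventually_le_const one_pos,
    absorb hγ.1 (a := c4/2*x^γ) (by positivity) D] with n hn1 hn2 hn3 hn4 hn5 μ hμ hμ1
  set t := (n:ℝ) * x with ht
  set l := c1 * t^(γ-1) with hl
  have htp : 0 < t := by linarith
  have hlp : 0 < l := by positivity
  set L := ⌊t/(8*M)⌋₊ with hL
  have hL1 : (L:ℝ) ≤ t/(8*M) := Nat.floor_le (by positivity)
  have hL2 : t/(16*M) ≤ L := by
    have h1 := Nat.lt_floor_add_one (t/(8*M))
    have h2 : 1 ≤ t/(16*M) := by rw [le_div_iff₀ (by positivity)]; linarith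
    have h3 : t/(8*M) = 2 * (t/(16*M)) := by field_simp; norm_num
    rw [← hL] at h1
    linarith
  have hLt : (L:ℝ) ≤ t := hL1.trans (div_le_self htp.le (by linarith))
  have hkey := key hγ hφ hM1 hM hCH hosc b L hlp hεp
    (fun μ hμ => hb l hlp hn3 L (fun r hr => by
      have := lam_cond hγ hκ hM1 (r := r) (t := t) (le_trans (by exact_mod_cast hr) hLt)
      rwa [← hc1, ← hl] at this) μ hμ) n μ hμ
  refine (bnd1 hγ hT hμ hμ1 (hK μ hμ) hφ (t := t) b L n hkey hlp).trans ?_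
  have hlt : l * t = c1 * t^γ := by
    rw [hl, Real.rpow_sub_one htp.ne']; field_simp
  have htn : t^γ = x^γ * (n:ℝ)^γ := by
    rw [ht, Real.mul_rpow (by positivity) hx.le, mul_comm]
  rw [← ENNReal.ofReal_add (by positivity) (by positivity)]
  apply ENNReal.ofReal_le_ofReal
  have e1 : Real.exp ((l*M+l*ε)*(b+L) - (l*t - l*ε*n)) ≤ Real.exp (2*M*b) * Real.exp (-c4 * t^γ) := by
    rw [← Real.exp_add, Real.exp_le_exp]
    have a1 : (l*M+l*ε)*(b+L) ≤ (l*M+l*M)*(b+t/(8*M)) := by gcongr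
    have a2 : (l*M+l*M)*(b+t/(8*M)) = 2*M*b*l + l*t/4 := by field_simp; ring
    have a3 : l*ε*n ≤ l*(x/4)*n := by gcongr
    have a4 : l*(x/4)*n = l*t/4 := by rw [ht]; ring
    have a5 : 2*M*b*l ≤ 2*M*b*1 := by gcongr
    have a6 : c4 * t^γ ≤ c1/2 * t^γ := by gcongr; exact min_le_right _ _
    have a7 : l*t/2 = c1/2 * t^γ := by rw [hlt]; ring
    linarith
  have e2 : ν.real (NN γ L) ≤ C * Real.exp (-c4 * t^γ) := by
    refine (htail L).trans ?_
    refine mul_le_mul_of_nonneg_left (Real.exp_le_exp.2 ?_) hC0.le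
    rw [neg_mul, neg_mul, neg_le_neg_iff]
    calc c4 * t^γ ≤ κ * (1/(16*M))^γ * t^γ := by gcongr; exact min_le_left _ _
      _ = κ * (t/(16*M))^γ := by
        rw [mul_assoc, ← Real.mul_rpow (by positivity) htp.le]; congr 2; ring
      _ ≤ κ * (L:ℝ)^γ := by gcongr; exact hγ.1.le
  have hn1' : (1:ℝ) ≤ n := by exact_mod_cast hn1
  have hb0 : (0:ℝ) ≤ b := by positivity
  have e3 : (n:ℝ)+b+1 ≤ (b+2)*n := by nlinarith
  calc (n+b+1) * (K * ν.real (NN γ L)) + Real.exp ((l*M+l*ε)*(b+L) - (l*t - l*ε*n))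
      ≤ ((b+2)*n) * (K * (C * Real.exp (-c4 * t^γ))) + Real.exp (2*M*b) * Real.exp (-c4 * t^γ) * n := by
        gcongr
        exact e1.trans (le_mul_of_one_le_right (by positivity) hn1')
    _ = (D * n) * Real.exp (-c4 * t^γ) := by rw [hD]; ring
    _ ≤ Real.exp (c4/2*x^γ*(n:ℝ)^γ) * Real.exp (-c4 * t^γ) := by gcongr
    _ = _ := by rw [← Real.exp_add, mul_assoc (c4/2), ← htn]; congr 1; ring

lemma step2 {γ : ℝ} (hγ : γ ∈ Ioo (0:ℝ) 1) {ν : Measure ℝ} [IsProbabilityMeasure ν]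
    (hac : ν ≪ volume) (h0 : ν (Ioc 0 1)ᶜ = 0) (hT : MeasurePreserving (Tmap γ) ν ν)
    {φ : ℝ → ℝ} (hφ : Measurable φ) {M : ℝ} (hM1 : 1 ≤ M) (hM : ∀ x, |φ x| ≤ M)
    (hmean : ∫ x, φ x ∂ν = 0) {CH : ℝ} (hCH : 0 ≤ CH)
    (hosc : ∀ n, ∀ y ∈ Ioc (0:ℝ) 1, ∀ z ∈ Ioc (0:ℝ) 1, code γ n y = code γ n z →
      |SS γ φ (n+1) y - SS γ φ (n+1) z| ≤ CH) :
    ∃ c : ℝ, 0 < c ∧ ∀ x : ℝ, 0 < x → ∀ᶠ n : ℕ in atTop,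
      ν {y | n * x ≤ SS γ φ n y} ≤ ENNReal.ofReal (Real.exp (-c * (n*x)^γ)) := by
  obtain ⟨c3, hc3, h3⟩ := step1 hγ hac h0 hT hφ hM1 hM hmean hCH hosc
  obtain ⟨C, hC0, htail⟩ := NN_tail hγ hac h0 hT
  have hkap := kap_pos (β := 1/γ-1)
  set κ := kap (1/γ-1)/2 with hκd
  have hκ : 0 < κ := by positivity
  have hMp : 0 < M := by linarith
  set c4 := min (κ * (1/(8*M))^γ) (c3 * (1/2)^γ) with hc4
  have hc4p : 0 < c4 := by
    apply lt_min <;> positivity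
  refine ⟨c4/2, by positivity, fun x hx => ?_⟩
  have htt : Tendsto (fun n : ℕ => (n:ℝ) * x) atTop atTop :=
    tendsto_natCast_atTop_atTop.atTop_mul_const hx
  filter_upwards [eventually_ge_atTop 1, htt.eventually_ge_atTop (8*M), h3 (x/2) (by positivity),
    absorb hγ.1 (a := c4/2*x^γ) (by positivity) (C + 2*x)] with n hn1 hn2 hn3 hn5
  set t := (n:ℝ) * x with ht
  have htp : 0 < t := by linarith
  set k := ⌊t/(4*M)⌋₊ with hk
  have hk1 : (k:ℝ) ≤ t/(4*M) := Nat.floor_le (by positivity)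
  have hk2 : t/(8*M) ≤ k := by
    have h1 := Nat.lt_floor_add_one (t/(4*M))
    have h2 : 1 ≤ t/(8*M) := by rw [le_div_iff₀ (by positivity)]; linarith
    have h3 : t/(4*M) = 2 * (t/(8*M)) := by field_simp; norm_num
    rw [← hk] at h1
    linarith
  have hkt : (k:ℝ) ≤ t := hk1.trans (div_le_self htp.le (by linarith))
  have htn : t^γ = x^γ * (n:ℝ)^γ := by
    rw [ht, Real.mul_rpow (by positivity) hx.le, mul_comm]
  set μ := (leb.restrict (Ioc (1/2) 1)).map (Tmap γ) with hμd
  have hμ : IsD γ μ := push_right hγ (isD_leb hγ).isC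
  have hμ1 : μ univ ≤ 1 := by
    rw [hμd, Measure.map_apply (T_meas γ) MeasurableSet.univ]
    exact (Measure.restrict_apply_le _ _).trans (leb_le_one _)
  set B : Set ℝ := {y | n * (x/2) ≤ SS γ φ n y} with hB
  have hBm : MeasurableSet B := measurableSet_le measurable_const (SS_meas hφ n)
  have hBμ := hn3 μ hμ hμ1
  have hP := invariant_pp hγ (ac_leb hac h0) hT
  set Z : Set ℝ := Ioc (1/2) 1 ∩ Tmap γ ⁻¹' B with hZ
  have hZm : MeasurableSet Z := measurableSet_Ioc.inter (T_meas γ hBm)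
  have hZν : ν Z ≤ 2 * μ B := by
    refine ((hP Z hZm).1 inter_subset_left).trans ?_
    rw [measure_univ, mul_one]
    refine mul_le_mul_of_nonneg_left ?_ zero_le
    rw [hμd, Measure.map_apply (T_meas γ) hBm, Measure.restrict_apply (T_meas γ hBm), leb,
      Measure.restrict_apply ((T_meas γ hBm).inter measurableSet_Ioc)]
    apply measure_mono
    intro z hz
    exact ⟨⟨hz.2, hz.1⟩, by linarith [hz.1.1], hz.1.2⟩
  have hsub : {y | t ≤ SS γ φ n y} ⊆ (Ioc 0 1)ᶜ ∪ (NN γ k ∪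
      ⋃ i ∈ Finset.range k, ((Tmap γ)^[i]) ⁻¹' Z) := by
    intro y hy
    by_cases hyI : y ∈ Ioc (0:ℝ) 1
    · right
      by_cases hyN : y ∈ NN γ k
      · exact Or.inl hyN
      · right
        have : ∃ i < k, 1/2 < (Tmap γ)^[i] y := by
          by_contra hcon
          push Not at hcon
          exact hyN ⟨hyI, hcon⟩
        obtain ⟨i, hi, hp⟩ := this
        simp only [mem_iUnion, Finset.mem_range]
        refine ⟨i, hi, ⟨hp, (Tn_mem hγ i hyI).2⟩, ?_⟩
        show n * (x/2) ≤ SS γ φ n (Tmap γ ((Tmap γ)^[i] y))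
        rw [← Function.iterate_succ_apply' (Tmap γ) i y]
        have e1 := SS_add (γ := γ) (φ := φ) n (i+1) y
        have e2 := SS_add (γ := γ) (φ := φ) (i+1) n y
        rw [add_comm (i+1) n] at e2
        have b1 := abs_le.1 (SS_bound (γ := γ) hM (i+1) y)
        have b2 := abs_le.1 (SS_bound (γ := γ) hM (i+1) ((Tmap γ)^[n] y))
        have hik : ((i+1:ℕ):ℝ) ≤ k := by exact_mod_cast hi
        have hMk : M * ((i+1:ℕ):ℝ) ≤ t/4 := by
          calc M * ((i+1:ℕ):ℝ) ≤ M * (t/(4*M)) := by gcongr; exact hik.trans hk1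
            _ = t/4 := by field_simp
        have hy' : t ≤ SS γ φ n y := hy
        have : (n:ℝ) * (x/2) = t/2 := by rw [ht]; ring
        rw [this]
        linarith [b1.1, b1.2, b2.1, b2.2]
    · exact Or.inl hyI
  refine (measure_mono hsub).trans ((measure_union_le _ _).trans ?_)
  rw [h0, zero_add]
  refine (measure_union_le _ _).trans ?_
  have e2 : ν (NN γ k) ≤ ENNReal.ofReal (C * Real.exp (-c4 * t^γ)) := by
    rw [← ofReal_measureReal]
    apply ENNReal.ofReal_le_ofReal
    refine (htail k).trans ?_
    refine mul_le_mul_of_nonneg_left (Real.exp_le_exp.2 ?_) hC0.le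
    rw [neg_mul, neg_mul, neg_le_neg_iff]
    calc c4 * t^γ ≤ κ * (1/(8*M))^γ * t^γ := by gcongr; exact min_le_left _ _
      _ = κ * (t/(8*M))^γ := by
        rw [mul_assoc, ← Real.mul_rpow (by positivity) htp.le]; congr 2; ring
      _ ≤ κ * (k:ℝ)^γ := by gcongr; exact hγ.1.le
  have e1 : μ B ≤ ENNReal.ofReal (Real.exp (-c4 * t^γ)) := by
    refine hBμ.trans ?_
    apply ENNReal.ofReal_le_ofReal
    rw [Real.exp_le_exp, neg_mul, neg_mul, neg_le_neg_iff]
    have : (n:ℝ) * (x/2) = (1/2) * t := by rw [ht]; ring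
    rw [this, Real.mul_rpow (by norm_num) htp.le, ← mul_assoc]
    gcongr
    exact min_le_right _ _
  have e3 : ν (⋃ i ∈ Finset.range k, ((Tmap γ)^[i]) ⁻¹' Z) ≤
      ENNReal.ofReal (2 * t * Real.exp (-c4 * t^γ)) := by
    refine (measure_biUnion_finset_le _ _).trans ?_
    have : ∀ i ∈ Finset.range k, ν (((Tmap γ)^[i]) ⁻¹' Z) ≤
        ENNReal.ofReal (2 * Real.exp (-c4 * t^γ)) := by
      intro i _
      rw [(hT.iterate i).measure_preimage hZm.nullMeasurableSet, ENNReal.ofReal_mul (by norm_num)]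
      refine hZν.trans ?_
      rw [ENNReal.ofReal_ofNat]
      gcongr
    refine (Finset.sum_le_sum this).trans ?_
    rw [Finset.sum_const, Finset.card_range, nsmul_eq_mul, ← ENNReal.ofReal_natCast,
      ← ENNReal.ofReal_mul (by positivity)]
    apply ENNReal.ofReal_le_ofReal
    calc (k:ℝ) * (2 * Real.exp (-c4 * t^γ)) ≤ t * (2 * Real.exp (-c4 * t^γ)) := by gcongr
      _ = _ := by ring
  refine (add_le_add e2 e3).trans ?_
  rw [← ENNReal.ofReal_add (by positivity) (by positivity)]
  apply ENNReal.ofReal_le_ofReal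
  have hn1' : (1:ℝ) ≤ n := by exact_mod_cast hn1
  calc C * Real.exp (-c4 * t^γ) + 2 * t * Real.exp (-c4 * t^γ)
      ≤ C * Real.exp (-c4 * t^γ) * n + 2 * t * Real.exp (-c4 * t^γ) := by
        refine add_le_add ?_ le_rfl
        exact (le_mul_of_one_le_right (by positivity) hn1')
    _ = ((C+2*x) * n) * Real.exp (-c4 * t^γ) := by rw [ht]; ring
    _ ≤ Real.exp (c4/2*x^γ*(n:ℝ)^γ) * Real.exp (-c4 * t^γ) := by gcongr
    _ = _ := by rw [← Real.exp_add, mul_assoc (c4/2), ← htn]; congr 1; ring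

end LD

/-- Large deviation upper bound: for `γ ∈ (0,1)` and an `η`-Hölder observable `φ` with
`∫ φ dν = 0`, there is `C1 > 0` such that for every `x > 0`,
`limsup_n n^{-γ} log ν(S_n(φ) ≥ n x) ≤ - x^γ / C1` (computed in the extended reals). -/
theorem stmt15 (γ : ℝ) (hγ : γ ∈ Set.Ioo (0 : ℝ) 1) (η : ℝ) (hη : η ∈ Set.Ioc (0 : ℝ) 1)
    (ν : Measure ℝ) [IsProbabilityMeasure ν]
    (hsupp : ν (Set.Icc (0 : ℝ) 1)ᶜ = 0) (hac : ν ≪ volume)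
    (hinv : ∀ A : Set ℝ, MeasurableSet A → ν (Tmap γ ⁻¹' A) = ν A)
    (φ : ℝ → ℝ)
    (hHol : ∃ Cφ : ℝ, ∀ x ∈ Set.Icc (0 : ℝ) 1, ∀ y ∈ Set.Icc (0 : ℝ) 1,
      |φ x - φ y| ≤ Cφ * |x - y| ^ η)
    (hmean : ∫ x, φ x ∂ν = 0) :
    ∃ C1 : ℝ, 0 < C1 ∧
      ∀ x : ℝ, 0 < x →
        Filter.limsup (fun n : ℕ =>
            (((n : ℝ) ^ (-γ) : ℝ) : EReal) *
              ENNReal.log (ν {y | (n : ℝ) * x ≤ ∑ k ∈ Finset.range n, φ ((Tmap γ)^[k] y)}))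
          Filter.atTop ≤ ((-(x ^ γ) / C1 : ℝ) : EReal) := by
  obtain ⟨C0, hC0⟩ := hHol
  set C := max C0 0 with hC
  have hCp : 0 ≤ C := le_max_right _ _
  have hHol : ∀ x ∈ Set.Icc (0 : ℝ) 1, ∀ y ∈ Set.Icc (0 : ℝ) 1,
      |φ x - φ y| ≤ C * |x - y| ^ η := fun x hx y hy => (hC0 x hx y hy).trans (by
        gcongr; exact le_max_left _ _)
  have h0 : ν (Ioc (0:ℝ) 1)ᶜ = 0 := by
    have h1 : (Ioc (0:ℝ) 1)ᶜ ⊆ (Icc 0 1)ᶜ ∪ {0} := by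
      intro y hy
      by_cases h : y = 0
      · exact Or.inr h
      · left
        intro h'
        exact hy ⟨lt_of_le_of_ne h'.1 (Ne.symm h), h'.2⟩
    refine measure_mono_null h1 (measure_union_null hsupp (hac ?_))
    simp
  have hT : MeasurePreserving (Tmap γ) ν ν := by
    refine ⟨LD.T_meas γ, ?_⟩
    ext A hA
    rw [Measure.map_apply (LD.T_meas γ) hA, hinv A hA]
  set pr : ℝ → ℝ := fun y => max 0 (min 1 y) with hpr
  have hpr_mem : ∀ y, pr y ∈ Icc (0:ℝ) 1 := fun y =>
    ⟨le_max_left _ _, max_le zero_le_one (min_le_left _ _)⟩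
  have hpr_eq : ∀ y ∈ Ioc (0:ℝ) 1, pr y = y := by
    intro y hy
    simp only [hpr]
    rw [min_eq_right hy.2, max_eq_right hy.1.le]
  have hpr_c : Continuous pr := by fun_prop
  set ψ : ℝ → ℝ := fun y => φ (pr y) with hψ
  have hφc : ContinuousOn φ (Icc 0 1) := by
    intro x hx
    rw [ContinuousWithinAt, tendsto_iff_dist_tendsto_zero]
    have hz : Tendsto (fun y => C * |y - x|^η) (nhdsWithin x (Icc 0 1)) (nhds 0) := by
      have hc : Continuous fun y : ℝ => C * |y - x|^η := by
        refine continuous_const.mul (Continuous.rpow_const (by fun_prop) fun _ => Or.inr hη.1.le)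
      have := hc.tendsto x
      simp only [sub_self, abs_zero, Real.zero_rpow hη.1.ne', mul_zero] at this
      exact this.mono_left nhdsWithin_le_nhds
    refine squeeze_zero' (Eventually.of_forall fun _ => dist_nonneg) ?_ hz
    filter_upwards [self_mem_nhdsWithin] with y hy
    exact hHol y hy x hx
  have hψc : Continuous ψ := hφc.comp_continuous hpr_c hpr_mem
  set M := 1 + |φ 0| + C with hM
  have hM1 : 1 ≤ M := by have := abs_nonneg (φ 0); linarith
  have hMb : ∀ y, |ψ y| ≤ M := by
    intro y
    have h1 := hHol (pr y) (hpr_mem y) 0 ⟨le_rfl, zero_le_one⟩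
    have h2 : |pr y - 0| ^ η ≤ 1 := by
      apply Real.rpow_le_one (abs_nonneg _) _ hη.1.le
      rw [sub_zero, abs_of_nonneg (hpr_mem y).1]; exact (hpr_mem y).2
    have h3 : C * |pr y - 0| ^ η ≤ C * 1 := by gcongr
    have h4 : |φ (pr y)| ≤ |φ (pr y) - φ 0| + |φ 0| := by
      have := abs_add_le (φ (pr y) - φ 0) (φ 0)
      rwa [sub_add_cancel] at this
    show |φ (pr y)| ≤ M
    linarith
  have hae : ∀ᵐ y ∂ν, y ∈ Ioc (0:ℝ) 1 := h0
  have hψm : ∫ y, ψ y ∂ν = 0 := by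
    rw [← hmean]
    apply integral_congr_ae
    filter_upwards [hae] with y hy
    simp only [hψ]; rw [hpr_eq y hy]
  have hψH : ∀ x ∈ Ioc (0:ℝ) 1, ∀ y ∈ Ioc (0:ℝ) 1, |ψ x - ψ y| ≤ C * |x-y| ^ η := by
    intro x hx y hy
    simp only [hψ]; rw [hpr_eq y hy, hpr_eq x hx]
    exact hHol x ⟨hx.1.le, hx.2⟩ y ⟨hy.1.le, hy.2⟩
  have hsum := LD.sum_EE hγ hη.1
  have hCH : 0 ≤ C * ∑' k, LD.EE γ k ^ η :=
    mul_nonneg hCp (tsum_nonneg fun k => Real.rpow_nonneg LD.EE_pos.le _)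
  obtain ⟨c, hc, h⟩ := LD.step2 hγ hac h0 hT hψc.measurable hM1 hMb hψm hCH
    (fun n y hy z hz hyz => LD.SS_osc hγ hη.1 hCp hψH hsum n hy hz hyz)
  refine ⟨1/c, by positivity, fun x hx => ?_⟩
  apply Filter.limsup_le_of_le
  · isBoundedDefault
  filter_upwards [h x hx, eventually_ge_atTop 1] with n hn hn1
  have hn1' : (0:ℝ) < n := by exact_mod_cast hn1
  have hset : ν {y | (n : ℝ) * x ≤ ∑ k ∈ Finset.range n, φ ((Tmap γ)^[k] y)} ≤
      ENNReal.ofReal (Real.exp (-c * (n*x)^γ)) := by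
    refine le_trans (measure_mono_ae ?_) hn
    filter_upwards [hae] with y hy hy2
    have : LD.SS γ ψ n y = ∑ k ∈ Finset.range n, φ ((Tmap γ)^[k] y) := by
      unfold LD.SS
      refine Finset.sum_congr rfl fun k _ => ?_
      simp only [hψ]; rw [hpr_eq _ (LD.Tn_mem hγ k hy)]
    show (n:ℝ) * x ≤ LD.SS γ ψ n y
    rw [this]; exact hy2
  have hlog : ENNReal.log (ν {y | (n : ℝ) * x ≤ ∑ k ∈ Finset.range n, φ ((Tmap γ)^[k] y)}) ≤
      ((-c * (n*x)^γ : ℝ) : EReal) := by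
    refine (ENNReal.log_monotone hset).trans ?_
    rw [ENNReal.log_ofReal_of_pos (Real.exp_pos _), Real.log_exp]
  have hp : (0:EReal) ≤ (((n : ℝ) ^ (-γ) : ℝ) : EReal) := by
    exact_mod_cast Real.rpow_nonneg hn1'.le _
  refine (mul_le_mul_of_nonneg_left hlog hp).trans ?_
  rw [← EReal.coe_mul]
  apply le_of_eq
  congr 1
  rw [Real.mul_rpow hn1'.le hx.le, Real.rpow_neg hn1'.le]
  have := Real.rpow_pos_of_pos hn1' γ
  field_simp
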